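/- arXiv:1909.03609 — 2 statements merged into one kernel-verified Lean document; each statement's English description precedes it below -/
import Mathlib

section
/- There exist positive constants A, ε₀, c, all independent of ε, p, and a, with the following property. Let a be any unit vector in ℝ³, let 0 < ε ≤ ε₀, let p = (0,0,p₃) with |p₃| ≤ 1/2, and let r₀ be a function such that: r₀ is harmonic on ℝ³ ∖ (closure of D₁ ∪ D₂ ∪ {p}); r₀ − a·∇N_p extends harmonically to a neighborhood of p; r₀ extends continuously to ∂D₁ ∪ ∂D₂ with boundary value 0 there; and r₀(x) = O(|x|⁻¹) as |x| → ∞. Then for all x ∈ ℝ³ ∖ (closure of D₁ ∪ D₂) with x ≠ p, |∇r₀(x)| ≤ c (|x−p|⁻³ + |x−p|⁻²) exp( −A|x−p| / ((√ε+|p₃|)|x−p| + ε + |p₃|²) ). -/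
open MeasureTheory Metric Real Filter
open scoped RealInnerProductSpace

noncomputable section

/-- Three-dimensional Euclidean space. -/
abbrev E3 : Type := EuclideanSpace ℝ (Fin 3)

/-- Standard basis vectors. -/
def e0 : E3 := EuclideanSpace.single 0 1
def e1 : E3 := EuclideanSpace.single 1 1
def e2 : E3 := EuclideanSpace.single 2 1

/-- Centers of the two unit balls at distance `ε`. -/
def ctr1 (ε : ℝ) : E3 := (-(1 + ε / 2)) • e0
def ctr2 (ε : ℝ) : E3 := (1 + ε / 2) • e0

/-- The two spherical inclusions. -/
def D1 (ε : ℝ) : Set E3 := Metric.ball (ctr1 ε) 1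
def D2 (ε : ℝ) : Set E3 := Metric.ball (ctr2 ε) 1

/-- The dipole field `a·∇N_p`, where `N_p(x) = -1/(4π|x-p|)` so that
`∇N_p(x) = (x-p)/(4π|x-p|³)`. -/
def dip (a p x : E3) : ℝ := ⟪a, x - p⟫ / (4 * π * ‖x - p‖ ^ 3)

/-- `f` is harmonic on the set `s`: it is twice continuously differentiable there and
its Laplacian vanishes at every point of `s`. -/
def IsHarmonicOn (f : E3 → ℝ) (s : Set E3) : Prop :=
  ContDiffOn ℝ 2 f s ∧
  ∀ x ∈ s, ∑ i : Fin 3,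
    fderiv ℝ (fun y => fderiv ℝ f y (EuclideanSpace.single i 1)) x
      (EuclideanSpace.single i 1) = 0

/-- The flux `∫_{∂B(c,1)} ∂_ν u dσ` across the unit sphere centered at `c`,
with `ν` the inward unit normal and `σ` the 2-dimensional Hausdorff (surface) measure. -/
def flux (u : E3 → ℝ) (c : E3) : ℝ :=
  ∫ x in Metric.sphere c 1, ⟪c - x, gradient u x⟫ ∂(μH[2])

/-- `u` is a solution of the emitter problem with dipole direction `a`, emitter location `p`,
inclusions `D1 ε`, `D2 ε`, and (unprescribed) constant boundary values `b₁`, `b₂`. -/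
structure IsEmitterSol (ε : ℝ) (p a : E3) (u : E3 → ℝ) (b₁ b₂ : ℝ) : Prop where
  /-- `u` is harmonic outside the closure of `D₁ ∪ D₂ ∪ {p}`. -/
  harm : IsHarmonicOn u (closure (D1 ε ∪ D2 ε) ∪ {p})ᶜ
  /-- `u - a·∇N_p` extends harmonically to a neighborhood of `p`. -/
  emitter : ∃ V : Set E3, IsOpen V ∧ p ∈ V ∧ ∃ h : E3 → ℝ, IsHarmonicOn h V ∧
      ∀ x ∈ V \ {p}, u x = dip a p x + h x
  /-- `u` extends continuously to `∂D₁` with constant value `b₁`. -/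
  bdry1 : ∀ x ∈ Metric.sphere (ctr1 ε) 1,
      Filter.Tendsto u (nhdsWithin x (closure (D1 ε ∪ D2 ε))ᶜ) (nhds b₁)
  /-- `u` extends continuously to `∂D₂` with constant value `b₂`. -/
  bdry2 : ∀ x ∈ Metric.sphere (ctr2 ε) 1,
      Filter.Tendsto u (nhdsWithin x (closure (D1 ε ∪ D2 ε))ᶜ) (nhds b₂)
  /-- zero flux across `∂D₁`. -/
  flux1 : flux u (ctr1 ε) = 0
  /-- zero flux across `∂D₂`. -/
  flux2 : flux u (ctr2 ε) = 0
  /-- `u(x) = O(|x|⁻²)` as `|x| → ∞`. -/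
  decay : ∃ C R : ℝ, ∀ x : E3, R ≤ ‖x‖ → |u x| ≤ C / ‖x‖ ^ 2

/-- The coordinate Laplacian used in `IsHarmonicOn`. -/
def lap (f : E3 → ℝ) (x : E3) : ℝ :=
  ∑ i : Fin 3, fderiv ℝ (fun y => fderiv ℝ f y (EuclideanSpace.single i 1)) x
    (EuclideanSpace.single i 1)

/-- `f` is `C²` at `x` with vanishing Laplacian there. -/
def HarmAt (f : E3 → ℝ) (x : E3) : Prop := ContDiffAt ℝ 2 f x ∧ lap f x = 0

theorem IsHarmonicOn.harmAt {f : E3 → ℝ} {s : Set E3} (h : IsHarmonicOn f s) (hs : IsOpen s)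
    {x : E3} (hx : x ∈ s) : HarmAt f x :=
  ⟨h.1.contDiffAt (hs.mem_nhds hx), h.2 x hx⟩

theorem ContDiffAt.eventually_differentiableAt_two {f : E3 → ℝ} {x : E3}
    (h : ContDiffAt ℝ 2 f x) : ∀ᶠ y in nhds x, DifferentiableAt ℝ f y :=
  (h.eventually (by simp)).mono fun _ hy => hy.differentiableAt (by simp)

theorem ContDiffAt.differentiableAt_fderiv_apply {f : E3 → ℝ} {x : E3}
    (h : ContDiffAt ℝ 2 f x) (v : E3) : DifferentiableAt ℝ (fun y => fderiv ℝ f y v) x := by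
  have h1 : ContDiffAt ℝ 1 (fderiv ℝ f) x := h.fderiv_right (by norm_num)
  exact (h1.differentiableAt (by simp)).clm_apply (differentiableAt_const v)

theorem lap_congr {f g : E3 → ℝ} {x : E3} (h : f =ᶠ[nhds x] g) : lap f x = lap g x := by
  unfold lap
  refine Finset.sum_congr rfl fun i _ => ?_
  have : (fun y => fderiv ℝ f y (EuclideanSpace.single i 1)) =ᶠ[nhds x]
      fun y => fderiv ℝ g y (EuclideanSpace.single i 1) :=
    h.fderiv.mono fun y hy => congrArg (fun L : E3 →L[ℝ] ℝ => L _) hy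
  rw [this.fderiv_eq]

theorem HarmAt.congr {f g : E3 → ℝ} {x : E3} (hf : HarmAt f x) (h : g =ᶠ[nhds x] f) :
    HarmAt g x :=
  ⟨hf.1.congr_of_eventuallyEq h, (lap_congr h).trans hf.2⟩

theorem lap_add {f g : E3 → ℝ} {x : E3} (hf : ContDiffAt ℝ 2 f x) (hg : ContDiffAt ℝ 2 g x) :
    lap (fun y => f y + g y) x = lap f x + lap g x := by
  unfold lap
  rw [← Finset.sum_add_distrib]
  refine Finset.sum_congr rfl fun i _ => ?_
  have : (fun y => fderiv ℝ (fun y => f y + g y) y (EuclideanSpace.single i 1)) =ᶠ[nhds x]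
      fun y => fderiv ℝ f y (EuclideanSpace.single i 1)
        + fderiv ℝ g y (EuclideanSpace.single i 1) := by
    filter_upwards [hf.eventually_differentiableAt_two, hg.eventually_differentiableAt_two]
      with y h1 h2
    rw [fderiv_fun_add h1 h2]; rfl
  rw [this.fderiv_eq, fderiv_fun_add (hf.differentiableAt_fderiv_apply _)
    (hg.differentiableAt_fderiv_apply _)]
  rfl

theorem lap_const_mul {f : E3 → ℝ} {x : E3} (hf : ContDiffAt ℝ 2 f x) (c : ℝ) :
    lap (fun y => c * f y) x = c * lap f x := by
  unfold lap
  rw [Finset.mul_sum]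
  refine Finset.sum_congr rfl fun i _ => ?_
  have : (fun y => fderiv ℝ (fun y => c * f y) y (EuclideanSpace.single i 1)) =ᶠ[nhds x]
      fun y => c * fderiv ℝ f y (EuclideanSpace.single i 1) := by
    filter_upwards [hf.eventually_differentiableAt_two] with y h1
    rw [fderiv_const_mul h1]; rfl
  rw [this.fderiv_eq, fderiv_const_mul (hf.differentiableAt_fderiv_apply _)]
  rfl

theorem lap_const (c : ℝ) (x : E3) : lap (fun _ => c) x = 0 := by
  simp [lap]

theorem harmAt_const (c : ℝ) (x : E3) : HarmAt (fun _ => c) x :=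
  ⟨contDiffAt_const, lap_const c x⟩

theorem HarmAt.add {f g : E3 → ℝ} {x : E3} (hf : HarmAt f x) (hg : HarmAt g x) :
    HarmAt (fun y => f y + g y) x :=
  ⟨hf.1.add hg.1, by rw [lap_add hf.1 hg.1, hf.2, hg.2, add_zero]⟩

theorem HarmAt.const_mul {f : E3 → ℝ} {x : E3} (hf : HarmAt f x) (c : ℝ) :
    HarmAt (fun y => c * f y) x :=
  ⟨contDiffAt_const.mul hf.1, by rw [lap_const_mul hf.1, hf.2, mul_zero]⟩

theorem HarmAt.neg {f : E3 → ℝ} {x : E3} (hf : HarmAt f x) : HarmAt (fun y => -f y) x := by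
  simpa using hf.const_mul (-1)

theorem HarmAt.sub {f g : E3 → ℝ} {x : E3} (hf : HarmAt f x) (hg : HarmAt g x) :
    HarmAt (fun y => f y - g y) x := by
  simpa [sub_eq_add_neg] using hf.add hg.neg

/-- Second-derivative test: at a local maximum the pure second derivatives are nonpositive. -/
theorem IsLocalMax.fderiv_fderiv_nonpos {f : E3 → ℝ} {z : E3} (hf : ContDiffAt ℝ 2 f z)
    (hm : IsLocalMax f z) (v : E3) : fderiv ℝ (fun y => fderiv ℝ f y v) z v ≤ 0 := by
  have hl : ∀ t : ℝ, HasDerivAt (fun s : ℝ => z + s • v) v t := fun t => by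
    simpa using ((hasDerivAt_id t).smul_const v).const_add z
  have hc : Tendsto (fun s : ℝ => z + s • v) (nhds 0) (nhds z) := by
    have := (hl 0).continuousAt.tendsto
    simpa using this
  set g : ℝ → ℝ := fun s => f (z + s • v) with hg
  have hgd : deriv g =ᶠ[nhds 0] fun s => fderiv ℝ f (z + s • v) v := by
    filter_upwards [hc.eventually hf.eventually_differentiableAt_two] with s hs
    exact (hs.hasFDerivAt.comp_hasDerivAt s (hl s)).deriv
  have hgdd : deriv (deriv g) 0 = fderiv ℝ (fun y => fderiv ℝ f y v) z v := by
    rw [hgd.deriv_eq]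
    have h1 : HasFDerivAt (fun y => fderiv ℝ f y v) (fderiv ℝ (fun y => fderiv ℝ f y v) z)
        (z + (0 : ℝ) • v) := by
      simpa using (hf.differentiableAt_fderiv_apply v).hasFDerivAt
    exact (h1.comp_hasDerivAt (0 : ℝ) (hl 0)).deriv
  have hgm : IsLocalMax g 0 := by
    have := hc.eventually hm
    simpa [IsLocalMax, IsMaxFilter, hg] using this
  rw [← hgdd]
  by_contra! hpos
  have hgc : ContinuousAt g 0 := by
    have : ContinuousAt f (z + (0 : ℝ) • v) := by simpa using hf.continuousAt
    exact ContinuousAt.comp (f := fun s : ℝ => z + s • v) this (hl 0).continuousAt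
  have hmin := isLocalMin_of_deriv_deriv_pos hpos hgm.deriv_eq_zero hgc
  have hconst : g =ᶠ[nhds 0] fun _ => g 0 := by
    filter_upwards [hmin, hgm] with s h1 h2
    exact le_antisymm h2 h1
  have : deriv (deriv g) 0 = 0 := by
    rw [hconst.deriv.deriv_eq]; simp
  linarith

theorem IsLocalMax.lap_nonpos {f : E3 → ℝ} {z : E3} (hf : ContDiffAt ℝ 2 f z)
    (hm : IsLocalMax f z) : lap f z ≤ 0 :=
  Finset.sum_nonpos fun _ _ => hm.fderiv_fderiv_nonpos hf _

theorem sum_inner_single_sq (x : E3) :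
    ∑ i : Fin 3, ⟪x, EuclideanSpace.single i (1 : ℝ)⟫ ^ 2 = ‖x‖ ^ 2 := by
  simp [EuclideanSpace.real_norm_sq_eq, EuclideanSpace.inner_single_right]

theorem sum_inner_mul_inner_single (x y : E3) :
    ∑ i : Fin 3, ⟪x, EuclideanSpace.single i (1 : ℝ)⟫ * ⟪y, EuclideanSpace.single i (1 : ℝ)⟫
      = ⟪x, y⟫ := by
  simp [PiLp.inner_apply, mul_comm]

theorem hasFDerivAt_norm_sub_sq (p x : E3) :
    HasFDerivAt (fun y : E3 => ‖y - p‖ ^ 2) ((2 : ℝ) • innerSL ℝ (x - p)) x := by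
  refine ((hasFDerivAt_id x).sub_const p).norm_sq.congr_fderiv ?_
  ext v; simp

theorem hasFDerivAt_inner_sub (a p x : E3) :
    HasFDerivAt (fun y : E3 => ⟪a, y - p⟫) (innerSL ℝ a) x := by
  exact (innerSL ℝ a).hasFDerivAt.comp x ((hasFDerivAt_id x).sub_const p)

theorem contDiff_norm_sub_sq (p : E3) : ContDiff ℝ 2 (fun y : E3 => ‖y - p‖ ^ 2) :=
  (contDiff_id.sub contDiff_const).norm_sq ℝ

theorem lap_norm_sq (x : E3) : lap (fun y => ‖y‖ ^ 2) x = 6 := by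
  have h1 : ∀ v y : E3, fderiv ℝ (fun y : E3 => ‖y‖ ^ 2) y v = 2 * ⟪v, y⟫ := fun v y => by
    have := (hasFDerivAt_norm_sub_sq 0 y).fderiv
    simp only [sub_zero] at this
    rw [this]; simp [real_inner_comm]
  have h2 : ∀ v : E3, fderiv ℝ (fun y : E3 => 2 * ⟪v, y⟫) x v = 2 * ‖v‖ ^ 2 := fun v => by
    have := ((hasFDerivAt_inner_sub v 0 x).const_mul 2).fderiv
    simp only [sub_zero] at this
    rw [this]; simp
  unfold lap
  simp only [h1, h2]
  simp; norm_num

/-- Laplacian of an affine function times a power of the distance to `p`. -/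
theorem lap_inner_mul_rpow (a p x : E3) (b k : ℝ) (hx : x ≠ p) :
    lap (fun y => (⟪a, y - p⟫ + b) * (‖y - p‖ ^ 2) ^ k) x =
      k * (‖x - p‖ ^ 2) ^ (k - 1) * ((4 * k + 2) * (⟪a, x - p⟫ + b) + 4 * ⟪a, x - p⟫) := by
  have hq : ∀ y : E3, y ≠ p → (0 : ℝ) < ‖y - p‖ ^ 2 := fun y hy => by
    have : 0 < ‖y - p‖ := norm_pos_iff.2 (sub_ne_zero.2 hy)
    positivity
  have hpow : ∀ (m : ℝ) (y : E3), y ≠ p → HasFDerivAt (fun y : E3 => (‖y - p‖ ^ 2) ^ m)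
      ((m * (‖y - p‖ ^ 2) ^ (m - 1)) • (2 : ℝ) • innerSL ℝ (y - p)) y := fun m y hy => by
    exact (Real.hasDerivAt_rpow_const (p := m) (Or.inl (hq y hy).ne')).comp_hasFDerivAt y
      (hasFDerivAt_norm_sub_sq p y)
  have hev : ∀ᶠ y in nhds x, y ≠ p := isOpen_ne.mem_nhds hx
  have h1 : ∀ v : E3, (fun y => fderiv ℝ
      (fun y : E3 => (⟪a, y - p⟫ + b) * (‖y - p‖ ^ 2) ^ k) y v) =ᶠ[nhds x]
      fun y => ⟪a, v⟫ * (‖y - p‖ ^ 2) ^ k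
        + (⟪a, y - p⟫ + b) * ((2 * k) * ((‖y - p‖ ^ 2) ^ (k - 1) * ⟪v, y - p⟫)) := fun v => by
    filter_upwards [hev] with y hy
    have := (((hasFDerivAt_inner_sub a p y).add_const b).mul (hpow k y hy)).fderiv
    refine (congrArg (fun L : E3 →L[ℝ] ℝ => L v) this).trans ?_
    generalize y - p = w
    simp [real_inner_comm]
    ring
  have h2 : ∀ v : E3, fderiv ℝ (fun y => fderiv ℝ
      (fun y : E3 => (⟪a, y - p⟫ + b) * (‖y - p‖ ^ 2) ^ k) y v) x v =
      4 * k * (‖x - p‖ ^ 2) ^ (k - 1) * (⟪a, v⟫ * ⟪x - p, v⟫)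
      + (⟪a, x - p⟫ + b) * (2 * k) * (2 * (k - 1) * (‖x - p‖ ^ 2) ^ (k - 1 - 1) * ⟪x - p, v⟫ ^ 2
        + (‖x - p‖ ^ 2) ^ (k - 1) * ‖v‖ ^ 2) := fun v => by
    rw [(h1 v).fderiv_eq]
    have := (((hpow k x hx).const_mul ⟪a, v⟫).add (((hasFDerivAt_inner_sub a p x).add_const b).mul
      (((hpow (k - 1) x hx).mul (hasFDerivAt_inner_sub v p x)).const_mul (2 * k)))).fderiv
    refine (congrArg (fun L : E3 →L[ℝ] ℝ => L v) this).trans ?_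
    simp only [Pi.mul_apply]
    generalize x - p = w
    simp [real_inner_comm]
    ring
  have hs : (‖x - p‖ ^ 2) ^ (k - 1 - 1) * ‖x - p‖ ^ 2 = (‖x - p‖ ^ 2) ^ (k - 1) := by
    rw [← Real.rpow_add_one (hq x hx).ne']; congr 1; ring
  unfold lap
  simp only [h2]
  rw [Finset.sum_add_distrib, ← Finset.mul_sum, ← Finset.mul_sum, Finset.sum_add_distrib,
    ← Finset.mul_sum, ← Finset.mul_sum, sum_inner_mul_inner_single, sum_inner_single_sq]
  simp only [PiLp.norm_single, norm_one, one_pow, Finset.sum_const, Finset.card_univ,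
    Fintype.card_fin, nsmul_eq_mul]
  rw [mul_assoc (2 * (k - 1)), hs]
  push_cast
  ring

theorem contDiffAt_inner_mul_rpow (a p x : E3) (b k : ℝ) (hx : x ≠ p) :
    ContDiffAt ℝ 2 (fun y => (⟪a, y - p⟫ + b) * (‖y - p‖ ^ 2) ^ k) x := by
  have h0 : ‖x - p‖ ^ 2 ≠ 0 := by
    have := sub_ne_zero.2 hx
    positivity
  refine ContDiffAt.mul ?_ ((contDiff_norm_sub_sq p).contDiffAt.rpow_const_of_ne h0)
  exact ((contDiff_const.inner ℝ (contDiff_id.sub contDiff_const)).add contDiff_const).contDiffAt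

/-- The Newtonian kernel is harmonic off its pole. -/
theorem harmAt_inv_norm (p x : E3) (hx : x ≠ p) : HarmAt (fun y => 1 / ‖y - p‖) x := by
  have he : (fun y : E3 => 1 / ‖y - p‖)
      = fun y => (⟪(0 : E3), y - p⟫ + 1) * (‖y - p‖ ^ 2) ^ (-(1 / 2) : ℝ) := by
    funext y
    rw [inner_zero_left, zero_add, one_mul, Real.rpow_neg (by positivity), ← Real.sqrt_eq_rpow,
      Real.sqrt_sq (norm_nonneg _), one_div]
  rw [he]
  refine ⟨contDiffAt_inner_mul_rpow _ _ _ _ _ hx, ?_⟩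
  rw [lap_inner_mul_rpow _ _ _ _ _ hx, inner_zero_left]
  ring

theorem harmAt_dip (a p x : E3) (hx : x ≠ p) : HarmAt (dip a p) x := by
  have he : dip a p = fun y => (1 / (4 * π)) *
      ((⟪a, y - p⟫ + 0) * (‖y - p‖ ^ 2) ^ (-(3 / 2) : ℝ)) := by
    funext y
    have : (‖y - p‖ ^ 2) ^ (3 / 2 : ℝ) = ‖y - p‖ ^ 3 := by
      rw [← Real.rpow_natCast, ← Real.rpow_mul (norm_nonneg _), ← Real.rpow_natCast]
      norm_num
    rw [Real.rpow_neg (by positivity), this, dip, add_zero]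
    simp only [div_eq_mul_inv, mul_inv]
    ring
  rw [he]
  refine HarmAt.const_mul ⟨contDiffAt_inner_mul_rpow _ _ _ _ _ hx, ?_⟩ _
  rw [lap_inner_mul_rpow _ _ _ _ _ hx]
  ring

theorem abs_dip_le (a p x : E3) (ha : ‖a‖ = 1) (hx : x ≠ p) : |dip a p x| ≤ 1 / ‖x - p‖ ^ 2 := by
  have h0 : 0 < ‖x - p‖ := norm_pos_iff.2 (sub_ne_zero.2 hx)
  have h1 : |⟪a, x - p⟫| ≤ ‖x - p‖ := by simpa [ha] using abs_real_inner_le_norm a (x - p)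
  have hpi := Real.pi_gt_three
  rw [dip, abs_div, abs_of_pos (by positivity : 0 < 4 * π * ‖x - p‖ ^ 3),
    div_le_div_iff₀ (by positivity) (by positivity)]
  calc |⟪a, x - p⟫| * ‖x - p‖ ^ 2 ≤ ‖x - p‖ * ‖x - p‖ ^ 2 := by gcongr
    _ = 1 * ‖x - p‖ ^ 3 := by ring
    _ ≤ 1 * (4 * π * ‖x - p‖ ^ 3) := by
      have : (1 : ℝ) ≤ 4 * π := by linarith
      rw [one_mul, one_mul]
      exact le_mul_of_one_le_left (by positivity) this

/-- Weak maximum principle on a possibly unbounded open set; the boundary condition at points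
outside the closure of `U` is vacuous. -/
theorem le_of_harmAt_of_boundary {U : Set E3} (hU : IsOpen U) {f : E3 → ℝ}
    (hf : ∀ x ∈ U, HarmAt f x) {m : ℝ}
    (hb : ∀ z, z ∉ U → ∀ η > 0, ∀ᶠ x in nhdsWithin z U, f x ≤ m + η)
    (hinf : ∀ η > 0, ∃ R : ℝ, ∀ x ∈ U, R ≤ ‖x‖ → f x ≤ m + η) :
    ∀ x ∈ U, f x ≤ m := by
  intro x0 hx0
  by_contra! hlt
  set η := (f x0 - m) / 4 with hη
  have hηpos : 0 < η := by rw [hη]; linarith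
  obtain ⟨R, hR⟩ := hinf η hηpos
  set R' := max R ‖x0‖ + 1 with hR'
  have hR1 : R < R' := by have := le_max_left R ‖x0‖; linarith
  have hR2 : ‖x0‖ < R' := by have := le_max_right R ‖x0‖; linarith
  have hR'pos : 0 < R' := (norm_nonneg _).trans_lt hR2
  set τ := η / R' ^ 2 with hτ
  have hτpos : 0 < τ := by positivity
  have hτR : τ * R' ^ 2 = η := by rw [hτ]; field_simp
  set w : E3 → ℝ := fun x => f x + τ * ‖x‖ ^ 2 with hw
  have hwc : ∀ x ∈ U, ContDiffAt ℝ 2 w x := fun x hx =>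
    (hf x hx).1.add (contDiffAt_const.mul (contDiff_norm_sq ℝ).contDiffAt)
  set K : Set E3 := {x | x ∈ U ∧ ‖x‖ ≤ R' ∧ w x0 ≤ w x} with hK
  have hKf : ∀ x ∈ K, m + 3 * η ≤ f x := by
    rintro x ⟨_, hxR, hxw⟩
    have h1 : τ * ‖x‖ ^ 2 ≤ τ * R' ^ 2 := by gcongr
    have h2 : 0 ≤ τ * ‖x0‖ ^ 2 := by positivity
    simp only [hw] at hxw
    have : f x0 = m + 4 * η := by rw [hη]; ring
    linarith
  have hKcl : IsClosed K := by
    refine isClosed_of_closure_subset fun z hz => ?_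
    have hne : (nhdsWithin z K).NeBot := mem_closure_iff_nhdsWithin_neBot.1 hz
    have hKU : K ⊆ U := fun x hx => hx.1
    have hzU : z ∈ U := by
      by_contra hzU
      have h1 := (hb z hzU η hηpos).filter_mono (nhdsWithin_mono z hKU)
      obtain ⟨x, hx1, hx2⟩ := (h1.and self_mem_nhdsWithin).exists
      have := hKf x hx2
      linarith
    refine ⟨hzU, ?_, ?_⟩
    · have : Tendsto (fun x : E3 => ‖x‖) (nhdsWithin z K) (nhds ‖z‖) :=
        continuous_norm.continuousAt.mono_left nhdsWithin_le_nhds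
      exact le_of_tendsto this (eventually_mem_nhdsWithin.mono fun x hx => hx.2.1)
    · have : Tendsto w (nhdsWithin z K) (nhds (w z)) :=
        (hwc z hzU).continuousAt.mono_left nhdsWithin_le_nhds
      exact ge_of_tendsto this (eventually_mem_nhdsWithin.mono fun x hx => hx.2.2)
  have hKc : IsCompact K :=
    (isCompact_closedBall (0 : E3) R').of_isClosed_subset hKcl fun x hx => by simpa using hx.2.1
  obtain ⟨z, hzK, hzmax⟩ := hKc.exists_isMaxOn ⟨x0, hx0, hR2.le, le_rfl⟩
    (fun x hx => (hwc x hx.1).continuousAt.continuousWithinAt)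
  have hzR : ‖z‖ < R' := by
    by_contra! h
    have h1 := hR z hzK.1 (hR1.le.trans h)
    have h2 := hKf z hzK
    linarith
  have hloc : IsLocalMax w z := by
    have h1 : ∀ᶠ x in nhds z, x ∈ U := hU.mem_nhds hzK.1
    have h2 : ∀ᶠ x in nhds z, ‖x‖ < R' := continuous_norm.continuousAt.eventually_lt_const hzR
    filter_upwards [h1, h2] with x hx1 hx2
    by_cases h : w x0 ≤ w x
    · exact hzmax ⟨hx1, hx2.le, h⟩
    · exact (not_le.1 h).le.trans hzK.2.2
  have h1 := hloc.lap_nonpos (hwc z hzK.1)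
  rw [hw, lap_add (hf z hzK.1).1 (contDiffAt_const.mul (contDiff_norm_sq ℝ).contDiffAt),
    lap_const_mul (contDiff_norm_sq ℝ).contDiffAt, lap_norm_sq, (hf z hzK.1).2] at h1
  linarith

theorem abs_le_of_harmAt_of_boundary {U : Set E3} (hU : IsOpen U) {f : E3 → ℝ}
    (hf : ∀ x ∈ U, HarmAt f x) {m : ℝ}
    (hb : ∀ z, z ∉ U → ∀ η > 0, ∀ᶠ x in nhdsWithin z U, |f x| ≤ m + η)
    (hinf : ∀ η > 0, ∃ R : ℝ, ∀ x ∈ U, R ≤ ‖x‖ → |f x| ≤ m + η) :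
    ∀ x ∈ U, |f x| ≤ m := by
  intro x hx
  refine abs_le'.2 ⟨?_, ?_⟩
  · refine le_of_harmAt_of_boundary hU hf (fun z hz η hη => ?_) (fun η hη => ?_) x hx
    · exact (hb z hz η hη).mono fun y hy => (le_abs_self _).trans hy
    · obtain ⟨R, hR⟩ := hinf η hη
      exact ⟨R, fun y hy h => (le_abs_self _).trans (hR y hy h)⟩
  · refine le_of_harmAt_of_boundary hU (f := fun y => -f y) (fun y hy => (hf y hy).neg)
      (fun z hz η hη => ?_) (fun η hη => ?_) x hx
    · exact (hb z hz η hη).mono fun y hy => (neg_le_abs _).trans hy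
    · obtain ⟨R, hR⟩ := hinf η hη
      exact ⟨R, fun y hy h => (neg_le_abs _).trans (hR y hy h)⟩

/-- The reflection reversing the `i`-th coordinate. -/
def coordRefl (i : Fin 3) : E3 →L[ℝ] E3 :=
  ContinuousLinearMap.id ℝ E3 -
    (2 : ℝ) • (EuclideanSpace.proj i : E3 →L[ℝ] ℝ).smulRight (EuclideanSpace.single i (1 : ℝ))

theorem coordRefl_apply (i : Fin 3) (w : E3) :
    coordRefl i w = w - (2 * w i) • EuclideanSpace.single i (1 : ℝ) := by
  simp [coordRefl, smul_smul]

theorem coordRefl_single (i j : Fin 3) : ∃ σ : ℝ, σ * σ = 1 ∧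
    coordRefl i (EuclideanSpace.single j (1 : ℝ)) = σ • EuclideanSpace.single j (1 : ℝ) := by
  rw [coordRefl_apply]
  by_cases h : i = j
  · subst h
    refine ⟨-1, by norm_num, ?_⟩
    simp only [PiLp.single_apply, if_true]
    module
  · exact ⟨1, by norm_num, by simp [h]⟩

theorem norm_coordRefl (i : Fin 3) (w : E3) : ‖coordRefl i w‖ = ‖w‖ := by
  have h : ‖coordRefl i w‖ ^ 2 = ‖w‖ ^ 2 := by
    rw [coordRefl_apply, norm_sub_sq_real, inner_smul_right, norm_smul,
      EuclideanSpace.inner_single_right, PiLp.norm_single]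
    simp [mul_pow]
    ring
  exact (sq_eq_sq₀ (norm_nonneg _) (norm_nonneg _)).1 h

theorem HarmAt.comp_coordRefl {u : E3 → ℝ} (i : Fin 3) (c x : E3)
    (hu : HarmAt u (c + coordRefl i (x - c))) :
    HarmAt (fun y => u (c + coordRefl i (y - c))) x := by
  set R : E3 → E3 := fun y => c + coordRefl i (y - c) with hR
  have hRd : ∀ y, HasFDerivAt R (coordRefl i) y := fun y =>
    ((coordRefl i).hasFDerivAt.comp y ((hasFDerivAt_id y).sub_const c)).const_add c
  have hRc : ContDiff ℝ 2 R :=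
    contDiff_const.add ((coordRefl i).contDiff.comp (contDiff_id.sub contDiff_const))
  refine ⟨ContDiffAt.comp x hu.1 hRc.contDiffAt, ?_⟩
  rw [← hu.2]
  unfold lap
  refine Finset.sum_congr rfl fun j _ => ?_
  obtain ⟨σ, hσ, hj⟩ := coordRefl_single i j
  have h1 : (fun y => fderiv ℝ (fun y => u (R y)) y (EuclideanSpace.single j 1)) =ᶠ[nhds x]
      fun y => σ * fderiv ℝ u (R y) (EuclideanSpace.single j 1) := by
    filter_upwards [hRc.continuous.continuousAt.eventually
      hu.1.eventually_differentiableAt_two] with y hy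
    have := (hy.hasFDerivAt.comp y (hRd y)).fderiv
    refine (congrArg (fun L : E3 →L[ℝ] ℝ => L (EuclideanSpace.single j 1)) this).trans ?_
    simp [hj]
  rw [h1.fderiv_eq]
  have h2 := (hu.1.differentiableAt_fderiv_apply (EuclideanSpace.single j 1)).hasFDerivAt
  have := ((h2.comp x (hRd x)).const_mul σ).fderiv
  refine (congrArg (fun L : E3 →L[ℝ] ℝ => L (EuclideanSpace.single j 1)) this).trans ?_
  simp only [_root_.smul_apply, ContinuousLinearMap.comp_apply, hj, map_smul,
    smul_eq_mul]
  rw [← mul_assoc, hσ, one_mul]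

theorem fderiv_single_le {u : E3 → ℝ} {x0 : E3} {d M : ℝ} (hd : 0 < d)
    (hu : ∀ x ∈ ball x0 d, HarmAt u x) (hM : ∀ x ∈ ball x0 d, |u x| ≤ M) (i : Fin 3) :
    fderiv ℝ u x0 (EuclideanSpace.single i 1) ≤ 4 * M / d := by
  set e : E3 := EuclideanSpace.single i 1 with he
  have hM0 : 0 ≤ M := (abs_nonneg _).trans (hM x0 (mem_ball_self hd))
  set R : E3 → E3 := fun y => x0 + coordRefl i (y - x0) with hR
  have hRc : Continuous R := by fun_prop
  have hRb : ∀ x ∈ ball x0 d, R x ∈ ball x0 d := fun x hx => by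
    simp only [hR, mem_ball, dist_eq_norm, add_sub_cancel_left, norm_coordRefl]
    simpa [dist_eq_norm] using hx
  set c : E3 := x0 - d • e with hc
  have hi : ∀ w : E3, ⟪w, e⟫ = w i := fun w => by
    simp [he, EuclideanSpace.inner_single_right]
  have hne : ‖e‖ = 1 := by simp [he]
  have hxc : ∀ x : E3, ‖x - c‖ ^ 2 = ‖x - x0‖ ^ 2 + 2 * d * (x - x0) i + d ^ 2 := fun x => by
    have : x - c = (x - x0) + d • e := by rw [hc]; abel
    rw [this, norm_add_sq_real, inner_smul_right, hi, norm_smul, hne, Real.norm_eq_abs,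
      abs_of_pos hd]
    ring
  set U : Set E3 := {x | x ∈ ball x0 d ∧ 0 < (x - x0) i} with hUdef
  have hcoord : Continuous fun x : E3 => (x - x0) i := by fun_prop
  have hU : IsOpen U := isOpen_ball.inter (isOpen_lt continuous_const hcoord)
  have hcpos : ∀ x ∈ U, d < ‖x - c‖ := fun x hx => by
    have h1 := hxc x
    have h2 := mul_pos hd hx.2
    have h3 := sq_nonneg ‖x - x0‖
    exact lt_of_pow_lt_pow_left₀ 2 (norm_nonneg _) (by nlinarith)
  have hb0 : ∀ x ∈ U, 0 ≤ 1 - d * (1 / ‖x - c‖) := fun x hx => by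
    have := hcpos x hx
    rw [mul_one_div, sub_nonneg, div_le_one (hd.trans this)]
    exact this.le
  set f : E3 → ℝ := fun x => (1 / 2) * (u x - u (R x)) - 4 * M * (1 - d * (1 / ‖x - c‖)) with hf
  have key : ∀ x ∈ U, f x ≤ 0 := by
    refine le_of_harmAt_of_boundary hU (fun x hx => ?_) (fun z hz η hη => ?_) (fun η hη => ?_)
    · have hxne : x ≠ c := by
        rintro rfl
        have := hcpos _ hx
        simp at this
        linarith
      exact (((hu x hx.1).sub ((hu _ (hRb x hx.1)).comp_coordRefl i x0 x)).const_mul _).sub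
        (((harmAt_const 1 x).sub ((harmAt_inv_norm c x hxne).const_mul d)).const_mul _)
    · by_cases hzb : z ∈ ball x0 d
      · have hzi : (z - x0) i ≤ 0 := by
          by_contra! h
          exact hz ⟨hzb, h⟩
        rcases hzi.lt_or_eq with hlt | heq
        · have : ∀ᶠ x in nhds z, (x - x0) i < 0 := hcoord.continuousAt.eventually_lt_const hlt
          filter_upwards [nhdsWithin_le_nhds this, self_mem_nhdsWithin] with x h1 h2
          exact absurd h2.2 h1.not_gt
        · have hRz : R z = z := by
            simp only [hR, coordRefl_apply, heq]
            simp
          have hcz : ContinuousAt (fun x => (1 / 2) * (u x - u (R x))) z := by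
            have h1 := (hu z hzb).1.continuousAt
            have h2 : ContinuousAt u (R z) := by rwa [hRz]
            exact continuousAt_const.mul (h1.sub (ContinuousAt.comp (f := R) h2 hRc.continuousAt))
          have : ∀ᶠ x in nhds z, (1 / 2) * (u x - u (R x)) < η := by
            refine hcz.eventually_lt_const ?_
            simpa [hRz] using hη
          filter_upwards [nhdsWithin_le_nhds this, self_mem_nhdsWithin] with x h1 h2
          have := mul_nonneg (mul_nonneg (by norm_num : (0 : ℝ) ≤ 4) hM0) (hb0 x h2)
          simp only [hf]
          linarith
      · have hzd : 0.95 * d < ‖z - x0‖ := by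
          have : d ≤ ‖z - x0‖ := by simpa [dist_eq_norm] using hzb
          linarith
        have hcn : Continuous fun x : E3 => ‖x - x0‖ := by fun_prop
        have : ∀ᶠ x in nhds z, 0.95 * d < ‖x - x0‖ := hcn.continuousAt.eventually_const_lt hzd
        filter_upwards [nhdsWithin_le_nhds this, self_mem_nhdsWithin] with x h1 h2
        have h3 := hxc x
        have h4 := mul_pos hd h2.2
        have h5 : 4 / 3 * d ≤ ‖x - c‖ :=
          le_of_sq_le_sq (by nlinarith) (norm_nonneg _)
        have h6 : d * (1 / ‖x - c‖) ≤ 3 / 4 := by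
          rw [mul_one_div, div_le_iff₀ (by linarith)]
          linarith
        have h7 := abs_le.1 (hM x h2.1)
        have h8 := abs_le.1 (hM (R x) (hRb x h2.1))
        have h9 : M ≤ 4 * M * (1 - d * (1 / ‖x - c‖)) := by nlinarith
        simp only [hf]
        linarith
    · refine ⟨‖x0‖ + d, fun x hx hxR => ?_⟩
      exfalso
      have h1 : ‖x - x0‖ < d := by simpa [dist_eq_norm] using hx.1
      have h2 := norm_sub_norm_le x x0
      linarith
  have hstep : ∀ s : ℝ, 0 < s → s < d → u (x0 + s • e) - u (x0 - s • e) ≤ 8 * M / d * s := by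
    intro s hs hsd
    have hei : e i = 1 := by simp [he]
    have hxU : x0 + s • e ∈ U := by
      refine ⟨?_, ?_⟩
      · simp [dist_eq_norm, norm_smul, hne, abs_of_pos hs, hsd]
      · simp [hei, hs]
    have h1 := key _ hxU
    have h2 : R (x0 + s • e) = x0 - s • e := by
      simp only [hR, coordRefl_apply, add_sub_cancel_left, PiLp.smul_apply, hei, ← he]
      simp only [smul_eq_mul, mul_one]
      module
    have h3 : ‖x0 + s • e - c‖ = s + d := by
      have : x0 + s • e - c = (s + d) • e := by rw [hc]; module
      rw [this, norm_smul, hne, Real.norm_eq_abs, abs_of_pos (by linarith), mul_one]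
    simp only [hf, h2, h3] at h1
    have h4 : 1 - d * (1 / (s + d)) ≤ s / d := by
      have h5 : 1 - d * (1 / (s + d)) = s / (s + d) := by
        field_simp
        ring
      rw [h5]
      gcongr
      linarith
    have h6 : 4 * M * (1 - d * (1 / (s + d))) ≤ 4 * M * (s / d) := by gcongr
    have h7 : 8 * M / d * s = 2 * (4 * M * (s / d)) := by ring
    linarith
  have hline : ∀ σ : ℝ, HasDerivAt (fun s : ℝ => x0 + (σ * s) • e) (σ • e) 0 := fun σ => by
    have := (((hasDerivAt_id (0 : ℝ)).const_mul σ).smul_const e).const_add x0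
    simpa using this
  have hdu : DifferentiableAt ℝ u x0 := (hu x0 (mem_ball_self hd)).1.differentiableAt (by simp)
  have hder : ∀ σ : ℝ, HasDerivAt (fun s : ℝ => u (x0 + (σ * s) • e)) (σ * fderiv ℝ u x0 e) 0 :=
    fun σ => by
      have h1 : HasFDerivAt u (fderiv ℝ u x0) (x0 + (σ * 0) • e) := by
        simpa using hdu.hasFDerivAt
      have h2 := h1.comp_hasDerivAt (0 : ℝ) (hline σ)
      rw [map_smul, smul_eq_mul] at h2
      exact h2
  have hg := ((hder 1).sub (hder (-1))).tendsto_slope_zero_right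
  have hle : ∀ᶠ t in nhdsWithin (0 : ℝ) (Set.Ioi 0),
      t⁻¹ • (((fun s : ℝ => u (x0 + (1 * s) • e)) - fun s : ℝ => u (x0 + (-1 * s) • e)) (0 + t) -
        ((fun s : ℝ => u (x0 + (1 * s) • e)) - fun s : ℝ => u (x0 + (-1 * s) • e)) 0)
        ≤ 8 * M / d := by
    filter_upwards [Ioo_mem_nhdsGT hd] with t ht
    have := hstep t ht.1 ht.2
    simp only [Pi.sub_apply, zero_add, one_mul, neg_mul, neg_smul, zero_smul,
      add_zero, sub_self, sub_zero, smul_eq_mul, ← sub_eq_add_neg]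
    rw [inv_mul_le_iff₀ ht.1]
    linarith
  have := le_of_tendsto hg hle
  have h8 : 8 * M / d = 2 * (4 * M / d) := by ring
  linarith

/-- Interior gradient estimate for harmonic functions. -/
theorem norm_gradient_le_of_ball {u : E3 → ℝ} {x0 : E3} {d M : ℝ} (hd : 0 < d)
    (hu : ∀ x ∈ ball x0 d, HarmAt u x) (hM : ∀ x ∈ ball x0 d, |u x| ≤ M) :
    ‖gradient u x0‖ ≤ 12 * M / d := by
  have hM0 : 0 ≤ M := (abs_nonneg _).trans (hM x0 (mem_ball_self hd))
  have hi : ∀ i : Fin 3, |fderiv ℝ u x0 (EuclideanSpace.single i 1)| ≤ 4 * M / d := fun i => by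
    refine abs_le'.2 ⟨fderiv_single_le hd hu hM i, ?_⟩
    have := fderiv_single_le hd (u := fun y => -u y) (fun x hx => (hu x hx).neg)
      (fun x hx => by simpa using hM x hx) i
    simpa [fderiv_fun_neg] using this
  rw [gradient, LinearIsometryEquiv.norm_map]
  refine ContinuousLinearMap.opNorm_le_bound _ (by positivity) fun v => ?_
  have hv : v = ∑ i : Fin 3, v i • EuclideanSpace.single i (1 : ℝ) := by
    ext j
    simp [Finset.sum_apply, Pi.single_apply]
  calc ‖fderiv ℝ u x0 v‖ = |∑ i : Fin 3, v i * fderiv ℝ u x0 (EuclideanSpace.single i 1)| := by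
        conv_lhs => rw [hv]
        rw [map_sum, Real.norm_eq_abs]
        simp
    _ ≤ ∑ i : Fin 3, |v i * fderiv ℝ u x0 (EuclideanSpace.single i 1)| :=
        Finset.abs_sum_le_sum_abs _ _
    _ ≤ ∑ _i : Fin 3, ‖v‖ * (4 * M / d) := by
        refine Finset.sum_le_sum fun i _ => ?_
        rw [abs_mul]
        have h1 : |v i| ≤ ‖v‖ := by simpa using PiLp.norm_apply_le v i
        exact mul_le_mul h1 (hi i) (abs_nonneg _) (norm_nonneg _)
    _ = 12 * M / d * ‖v‖ := by
        simp; ring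

theorem le_of_exterior_ball {Ω : Set E3} (hΩ : IsOpen Ω) {c : E3} (hc : ∀ x ∈ Ω, 1 < ‖x - c‖)
    {u : E3 → ℝ} {y : E3} {r d M : ℝ} (hy : y ∈ Ω) (hyd : ‖y - c‖ = 1 + d) (hd : 0 < d)
    (hdr : d < r) (hr : r ≤ 1 / 2)
    (hu : ∀ x ∈ Ω, ‖x - y‖ < r + d → HarmAt u x)
    (hb : ∀ z, z ∉ Ω → Tendsto u (nhdsWithin z Ω) (nhds 0))
    (hM : ∀ x ∈ Ω, ‖x - y‖ < r + d → u x ≤ M) (hM0 : 0 ≤ M) :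
    u y ≤ 6 * M * (d / (r + d)) := by
  have hr0 : 0 < r := hd.trans hdr
  set ν : E3 := (1 + d)⁻¹ • (y - c) with hν
  have hν1 : ‖ν‖ = 1 := by
    rw [hν, norm_smul, hyd, norm_inv, Real.norm_eq_abs, abs_of_pos (by linarith)]
    exact inv_mul_cancel₀ (by linarith)
  have hyν : y = c + (1 + d) • ν := by
    rw [hν, smul_smul, mul_inv_cancel₀ (by linarith : (1 + d) ≠ 0), one_smul]
    abel
  set z : E3 := c + ν with hz
  set c' : E3 := c + (1 - r) • ν with hc'
  have hyz : ‖y - z‖ = d := by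
    have : y - z = d • ν := by rw [hz]; nth_rw 1 [hyν]; module
    rw [this, norm_smul, hν1, Real.norm_eq_abs, abs_of_pos hd, mul_one]
  have hyc' : ‖y - c'‖ = r + d := by
    have : y - c' = (r + d) • ν := by rw [hc']; nth_rw 1 [hyν]; module
    rw [this, norm_smul, hν1, Real.norm_eq_abs, abs_of_pos (by linarith), mul_one]
  have hdist : ∀ x ∈ Ω, r ^ 2 + ‖x - z‖ ^ 2 / 2 ≤ ‖x - c'‖ ^ 2 := fun x hx => by
    have h1 : x - c' = (x - z) + r • ν := by rw [hz, hc']; module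
    have h2 : x - c = (x - z) + ν := by rw [hz]; abel
    have h3 := hc x hx
    have h4 : 1 < ‖x - c‖ ^ 2 := by nlinarith
    rw [h2, norm_add_sq_real, hν1] at h4
    rw [h1, norm_add_sq_real, inner_smul_right, norm_smul, hν1, Real.norm_eq_abs,
      abs_of_pos hr0]
    nlinarith [sq_nonneg ‖x - z‖]
  have hpos : ∀ x ∈ Ω, r ≤ ‖x - c'‖ := fun x hx => by
    have := hdist x hx
    have h2 := sq_nonneg ‖x - z‖
    exact le_of_sq_le_sq (by linarith) (norm_nonneg _)
  have hb0 : ∀ x ∈ Ω, 0 ≤ 1 - r * (1 / ‖x - c'‖) := fun x hx => by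
    have := hpos x hx
    rw [mul_one_div, sub_nonneg, div_le_one (hr0.trans_le this)]
    exact this
  have hsub : ∀ x ∈ ball z r, ‖x - y‖ < r + d := fun x hx => by
    have h1 : ‖x - z‖ < r := by simpa [dist_eq_norm] using hx
    have h2 := norm_sub_le_norm_sub_add_norm_sub x z y
    rw [norm_sub_rev z y, hyz] at h2
    linarith
  have key : ∀ x ∈ Ω ∩ ball z r, u x - 6 * M * (1 - r * (1 / ‖x - c'‖)) ≤ 0 := by
    refine le_of_harmAt_of_boundary (hΩ.inter isOpen_ball) (fun x hx => ?_)
      (fun z' hz' η hη => ?_) (fun η hη => ?_)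
    · have hxne : x ≠ c' := by
        rintro rfl
        have := hpos _ hx.1
        simp at this
        linarith
      exact (hu x hx.1 (hsub x hx.2)).sub
        (((harmAt_const 1 x).sub ((harmAt_inv_norm c' x hxne).const_mul r)).const_mul _)
    · by_cases hzΩ : z' ∈ Ω
      · have hzd : 0.95 * r < ‖z' - z‖ := by
          have : r ≤ ‖z' - z‖ := by
            by_contra! h
            exact hz' ⟨hzΩ, by simpa [dist_eq_norm] using h⟩
          linarith
        have hcn : Continuous fun x : E3 => ‖x - z‖ := by fun_prop
        have : ∀ᶠ x in nhds z', 0.95 * r < ‖x - z‖ := hcn.continuousAt.eventually_const_lt hzd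
        filter_upwards [nhdsWithin_le_nhds this, self_mem_nhdsWithin] with x h1 h2
        have h3 := hdist x h2.1
        have h5 : 6 / 5 * r ≤ ‖x - c'‖ := le_of_sq_le_sq (by nlinarith) (norm_nonneg _)
        have h6 : r * (1 / ‖x - c'‖) ≤ 5 / 6 := by
          rw [mul_one_div, div_le_iff₀ (by linarith)]
          linarith
        have h7 := hM x h2.1 (hsub x h2.2)
        nlinarith
      · have h1 := (hb z' hzΩ).eventually_lt_const hη
        have h2 : ∀ᶠ x in nhdsWithin z' (Ω ∩ ball z r), u x < η :=
          nhdsWithin_mono z' Set.inter_subset_left h1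
        filter_upwards [h2, self_mem_nhdsWithin] with x h3 h4
        have := mul_nonneg (mul_nonneg (by norm_num : (0 : ℝ) ≤ 6) hM0) (hb0 x h4.1)
        linarith
    · refine ⟨‖z‖ + r, fun x hx hxR => ?_⟩
      exfalso
      have h1 : ‖x - z‖ < r := by simpa [dist_eq_norm] using hx.2
      have h2 := norm_sub_norm_le x z
      linarith
  have h1 := key y ⟨hy, by simpa [dist_eq_norm, hyz] using hdr⟩
  rw [hyc'] at h1
  have h2 : 1 - r * (1 / (r + d)) = d / (r + d) := by
    field_simp
    ring
  rw [h2] at h1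
  linarith

/-- Boundary decay at a point with an exterior unit ball nearby. -/
theorem abs_le_of_exterior_ball {Ω : Set E3} (hΩ : IsOpen Ω) {c : E3}
    (hc : ∀ x ∈ Ω, 1 < ‖x - c‖)
    {u : E3 → ℝ} {y : E3} {r d M : ℝ} (hy : y ∈ Ω) (hyd : ‖y - c‖ = 1 + d) (hd : 0 < d)
    (hdr : d < r) (hr : r ≤ 1 / 2)
    (hu : ∀ x ∈ Ω, ‖x - y‖ < r + d → HarmAt u x)
    (hb : ∀ z, z ∉ Ω → Tendsto u (nhdsWithin z Ω) (nhds 0))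
    (hM : ∀ x ∈ Ω, ‖x - y‖ < r + d → |u x| ≤ M) :
    |u y| ≤ 6 * M * (d / (r + d)) := by
  have hM0 : 0 ≤ M := (abs_nonneg _).trans (hM y hy (by simp; linarith))
  refine abs_le'.2 ⟨?_, ?_⟩
  · exact le_of_exterior_ball hΩ hc hy hyd hd hdr hr hu hb
      (fun x hx h => (le_abs_self _).trans (hM x hx h)) hM0
  · exact le_of_exterior_ball (u := fun x => -u x) hΩ hc hy hyd hd hdr hr
      (fun x hx h => (hu x hx h).neg) (fun z hz => by simpa using (hb z hz).neg)
      (fun x hx h => (neg_le_abs _).trans (hM x hx h)) hM0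

/-- Gradient estimate up to the boundary for harmonic functions vanishing on the boundary of the
complement of two unit balls; it is uniform in the distance between the balls. -/
theorem norm_gradient_le_of_two_balls {Ω : Set E3} {c₁ c₂ : E3}
    (hΩ : ∀ x, x ∈ Ω ↔ 1 < ‖x - c₁‖ ∧ 1 < ‖x - c₂‖)
    {u : E3 → ℝ} {x : E3} {ρ M : ℝ} (hx : x ∈ Ω) (hρ : 0 < ρ) (hρ1 : ρ ≤ 1)
    (hu : ∀ y ∈ Ω, ‖y - x‖ < ρ → HarmAt u y)
    (hb : ∀ z, z ∉ Ω → Tendsto u (nhdsWithin z Ω) (nhds 0))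
    (hM : ∀ y ∈ Ω, ‖y - x‖ < ρ → |u y| ≤ M) :
    ‖gradient u x‖ ≤ 432 * M / ρ := by
  wlog hle : ‖x - c₁‖ ≤ ‖x - c₂‖ generalizing c₁ c₂
  · exact this (c₁ := c₂) (c₂ := c₁) (fun x => (hΩ x).trans and_comm) (le_of_not_ge hle)
  have hΩo : IsOpen Ω := by
    have : Ω = {x | 1 < ‖x - c₁‖} ∩ {x | 1 < ‖x - c₂‖} := Set.ext fun x => hΩ x
    rw [this]
    exact (isOpen_lt continuous_const (by fun_prop)).inter
      (isOpen_lt continuous_const (by fun_prop))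
  have hM0 : 0 ≤ M := (abs_nonneg _).trans (hM x hx (by simpa using hρ))
  set d := ‖x - c₁‖ - 1 with hd
  have hd0 : 0 < d := by have := ((hΩ x).1 hx).1; rw [hd]; linarith
  have hball : ∀ y : E3, ‖y - x‖ < d → y ∈ Ω := fun y hy => by
    have h1 := norm_sub_le_norm_sub_add_norm_sub x y c₁
    have h2 := norm_sub_le_norm_sub_add_norm_sub x y c₂
    rw [norm_sub_rev x y] at h1 h2
    exact (hΩ y).2 ⟨by linarith, by linarith⟩
  rcases le_or_gt (ρ / 8) d with hcase | hcase
  · have h1 : ∀ y ∈ ball x (ρ / 8), ‖y - x‖ < ρ / 8 := fun y hy => by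
      simpa [dist_eq_norm] using hy
    have := norm_gradient_le_of_ball (u := u) (x0 := x) (d := ρ / 8) (M := M) (by positivity)
      (fun y hy => hu y (hball y ((h1 y hy).trans_le hcase)) (by linarith [h1 y hy]))
      (fun y hy => hM y (hball y ((h1 y hy).trans_le hcase)) (by linarith [h1 y hy]))
    refine this.trans ?_
    rw [div_le_div_iff₀ (by positivity) hρ]
    nlinarith
  · have h1 : ∀ y ∈ ball x (d / 2), ‖y - x‖ < d / 2 := fun y hy => by
      simpa [dist_eq_norm] using hy
    have h2 : ∀ y ∈ ball x (d / 2), y ∈ Ω := fun y hy => hball y (by linarith [h1 y hy])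
    have h3 : ∀ y ∈ ball x (d / 2), |u y| ≤ 18 * M * d / ρ := fun y hy => by
      have hyx := h1 y hy
      have h4 := ((hΩ y).1 (h2 y hy)).1
      have h5 := norm_sub_le_norm_sub_add_norm_sub y x c₁
      have h6 : ∀ w : E3, ‖w - y‖ < ρ / 2 + (‖y - c₁‖ - 1) → ‖w - x‖ < ρ := fun w hw => by
        have := norm_sub_le_norm_sub_add_norm_sub w y x
        linarith
      have h7 := abs_le_of_exterior_ball (u := u) (y := y) (r := ρ / 2) (d := ‖y - c₁‖ - 1)
        (M := M) hΩo (fun w hw => ((hΩ w).1 hw).1) (h2 y hy) (by ring) (by linarith)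
        (by linarith) (by linarith) (fun w hw h => hu w hw (h6 w h)) hb
        (fun w hw h => hM w hw (h6 w h))
      refine h7.trans ?_
      have h8 : (‖y - c₁‖ - 1) / (ρ / 2 + (‖y - c₁‖ - 1)) ≤ 3 * d / ρ := by
        rw [div_le_div_iff₀ (by linarith) hρ]
        nlinarith
      calc 6 * M * ((‖y - c₁‖ - 1) / (ρ / 2 + (‖y - c₁‖ - 1))) ≤ 6 * M * (3 * d / ρ) := by gcongr
        _ = 18 * M * d / ρ := by ring
    have := norm_gradient_le_of_ball (u := u) (x0 := x) (d := d / 2) (by positivity)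
      (fun y hy => hu y (h2 y hy) (by linarith [h1 y hy])) h3
    refine this.trans (le_of_eq ?_)
    field_simp
    ring

/-- The complement of the two closed inclusions. -/
def gap (ε : ℝ) : Set E3 := (closure (D1 ε ∪ D2 ε))ᶜ

theorem mem_gap {ε : ℝ} {x : E3} : x ∈ gap ε ↔ 1 < ‖x - ctr1 ε‖ ∧ 1 < ‖x - ctr2 ε‖ := by
  rw [gap, closure_union, D1, D2, closure_ball _ one_ne_zero, closure_ball _ one_ne_zero]
  simp [dist_eq_norm]

theorem isOpen_gap (ε : ℝ) : IsOpen (gap ε) := isClosed_closure.isOpen_compl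

theorem norm_smul_e2 (q : ℝ) : ‖q • e2‖ = |q| := by
  simp [norm_smul, e2]

theorem norm_sub_ctr1_sq (ε : ℝ) (x : E3) :
    ‖x - ctr1 ε‖ ^ 2 = ‖x‖ ^ 2 + 2 * (1 + ε / 2) * x 0 + (1 + ε / 2) ^ 2 := by
  simp [EuclideanSpace.real_norm_sq_eq, Fin.sum_univ_three, ctr1, e0]
  ring

theorem norm_sub_ctr2_sq (ε : ℝ) (x : E3) :
    ‖x - ctr2 ε‖ ^ 2 = ‖x‖ ^ 2 - 2 * (1 + ε / 2) * x 0 + (1 + ε / 2) ^ 2 := by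
  simp [EuclideanSpace.real_norm_sq_eq, Fin.sum_univ_three, ctr2, e0]
  ring

theorem smul_e2_zero (q : ℝ) : (q • e2 : E3) 0 = 0 := by
  simp [e2]

theorem le_norm_sub_of_notMem_gap {ε q : ℝ} (hε : 0 < ε) (hε1 : ε ≤ 1) (hq : |q| ≤ 1 / 2)
    {z : E3} (hz : z ∉ gap ε) : (ε + q ^ 2) / 4 ≤ ‖z - q • e2‖ := by
  have hq2 : q ^ 2 ≤ 1 / 4 := by nlinarith [sq_abs q, abs_nonneg q]
  have aux : ∀ c : E3, ‖q • e2 - c‖ ^ 2 = q ^ 2 + (1 + ε / 2) ^ 2 → ‖z - c‖ ≤ 1 →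
      (ε + q ^ 2) / 4 ≤ ‖z - q • e2‖ := by
    intro c h1 h2
    have h3 : 1 + (ε + q ^ 2) / 4 ≤ ‖q • e2 - c‖ :=
      le_of_sq_le_sq (by rw [h1]; nlinarith [sq_nonneg q, sq_nonneg ε]) (norm_nonneg _)
    have h4 := norm_sub_le_norm_sub_add_norm_sub (q • e2) z c
    rw [norm_sub_rev (q • e2) z] at h4
    linarith
  rw [mem_gap, not_and_or, not_lt, not_lt] at hz
  rcases hz with h | h
  · exact aux _ (by rw [norm_sub_ctr1_sq, norm_smul_e2, smul_e2_zero, sq_abs]; ring) h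
  · exact aux _ (by rw [norm_sub_ctr2_sq, norm_smul_e2, smul_e2_zero, sq_abs]; ring) h

theorem mem_gap_of_three_le_norm {ε : ℝ} (hε : 0 < ε) (hε1 : ε ≤ 1) {x : E3} (hx : 3 ≤ ‖x‖) :
    x ∈ gap ε := by
  have h0 : ‖e0‖ = 1 := by simp [e0]
  have h1 : ‖ctr1 ε‖ = 1 + ε / 2 := by
    rw [ctr1, norm_smul, h0, norm_neg, Real.norm_eq_abs, abs_of_pos (by linarith), mul_one]
  have h2 : ‖ctr2 ε‖ = 1 + ε / 2 := by
    rw [ctr2, norm_smul, h0, Real.norm_eq_abs, abs_of_pos (by linarith), mul_one]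
  have h3 := norm_sub_norm_le x (ctr1 ε)
  have h4 := norm_sub_norm_le x (ctr2 ε)
  exact mem_gap.2 ⟨by linarith, by linarith⟩

theorem exists_ctr_norm_sub_le {ε : ℝ} (hε : 0 < ε) (hε1 : ε ≤ 1) (y : E3) :
    ∃ c : E3, (∀ x ∈ gap ε, 1 < ‖x - c‖) ∧ 2 * (‖y - c‖ - 1) ≤ ‖y‖ ^ 2 + 5 / 4 * ε := by
  have aux : ∀ c : E3, ‖y - c‖ ^ 2 ≤ ‖y‖ ^ 2 + (1 + ε / 2) ^ 2 →
      2 * (‖y - c‖ - 1) ≤ ‖y‖ ^ 2 + 5 / 4 * ε := fun c h => by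
    nlinarith [sq_nonneg (‖y - c‖ - 1)]
  rcases le_total (y 0) 0 with h | h
  · refine ⟨ctr1 ε, fun x hx => (mem_gap.1 hx).1, aux _ ?_⟩
    rw [norm_sub_ctr1_sq]
    nlinarith
  · refine ⟨ctr2 ε, fun x hx => (mem_gap.1 hx).2, aux _ ?_⟩
    rw [norm_sub_ctr2_sq]
    nlinarith

/-- Solutions of the emitter problem at `q • e2` with zero boundary values. -/
structure IsZeroBdrySol (ε q : ℝ) (a : E3) (u : E3 → ℝ) : Prop where
  harm : ∀ x ∈ gap ε, x ≠ q • e2 → HarmAt u x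
  emitter : ∃ V : Set E3, IsOpen V ∧ q • e2 ∈ V ∧ ∃ h : E3 → ℝ, IsHarmonicOn h V ∧
    ∀ x ∈ V \ {q • e2}, u x = dip a (q • e2) x + h x
  bdry : ∀ z, z ∉ gap ε → Tendsto u (nhdsWithin z (gap ε)) (nhds 0)
  decay : ∃ C R : ℝ, ∀ x : E3, R ≤ ‖x‖ → |u x| ≤ C / ‖x‖

theorem IsZeroBdrySol.of_hypotheses {ε q : ℝ} {a : E3} {u : E3 → ℝ}
    (harm : IsHarmonicOn u (closure (D1 ε ∪ D2 ε) ∪ {q • e2})ᶜ)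
    (emitter : ∃ V : Set E3, IsOpen V ∧ q • e2 ∈ V ∧ ∃ h : E3 → ℝ, IsHarmonicOn h V ∧
      ∀ x ∈ V \ {q • e2}, u x = dip a (q • e2) x + h x)
    (bdry : ∀ x ∈ Metric.sphere (ctr1 ε) 1 ∪ Metric.sphere (ctr2 ε) 1,
      Tendsto u (nhdsWithin x (closure (D1 ε ∪ D2 ε))ᶜ) (nhds 0))
    (decay : ∃ C R : ℝ, ∀ x : E3, R ≤ ‖x‖ → |u x| ≤ C / ‖x‖) : IsZeroBdrySol ε q a u where
  harm x hx hxp := by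
    refine harm.harmAt (isClosed_closure.union isClosed_singleton).isOpen_compl ?_
    rintro (h | h)
    · exact hx h
    · exact hxp h
  emitter := emitter
  decay := decay
  bdry z hz := by
    have aux : ∀ c : E3, (∀ x ∈ gap ε, 1 < ‖x - c‖) → ‖z - c‖ < 1 →
        Tendsto u (nhdsWithin z (gap ε)) (nhds 0) := fun c hc h => by
      have h1 : ∀ᶠ x in nhds z, ‖x - c‖ < 1 :=
        (by fun_prop : Continuous fun x : E3 => ‖x - c‖).continuousAt.eventually_lt_const h
      have h2 : nhdsWithin z (gap ε) = ⊥ := by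
        rw [← Filter.eventually_false_iff_eq_bot]
        filter_upwards [nhdsWithin_le_nhds h1, self_mem_nhdsWithin] with x h3 h4
        exact (hc x h4).not_gt h3
      rw [h2]
      exact tendsto_bot
    have hz' := hz
    rw [mem_gap, not_and_or, not_lt, not_lt] at hz'
    rcases hz' with h | h
    · rcases h.lt_or_eq with h | h
      · exact aux _ (fun x hx => (mem_gap.1 hx).1) h
      · exact bdry z (Or.inl (by simpa [dist_eq_norm] using h))
    · rcases h.lt_or_eq with h | h
      · exact aux _ (fun x hx => (mem_gap.1 hx).2) h
      · exact bdry z (Or.inr (by simpa [dist_eq_norm] using h))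

section

variable {ε q : ℝ} {a : E3} {u : E3 → ℝ}

theorem IsZeroBdrySol.exists_abs_le (hu : IsZeroBdrySol ε q a u) {η : ℝ} (hη : 0 < η) :
    ∃ R : ℝ, ∀ x : E3, R ≤ ‖x‖ → |u x| ≤ η := by
  obtain ⟨C, R, hR⟩ := hu.decay
  refine ⟨max R (|C| / η + 1), fun x hx => (hR x ((le_max_left _ _).trans hx)).trans ?_⟩
  have h1 : |C| / η + 1 ≤ ‖x‖ := (le_max_right _ _).trans hx
  have h2 : 0 ≤ |C| / η := by positivity
  rw [div_le_iff₀ (by linarith)]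
  have h3 : |C| / η * η = |C| := by field_simp
  nlinarith [le_abs_self C]

theorem IsZeroBdrySol.abs_le_near (hu : IsZeroBdrySol ε q a u) (ha : ‖a‖ = 1) (hε : 0 < ε)
    (hε1 : ε ≤ 1) (hq : |q| ≤ 1 / 2) {x : E3} (hx : x ∈ gap ε) (hxp : x ≠ q • e2) :
    |u x| ≤ 1 / ‖x - q • e2‖ ^ 2 + 16 / (ε + q ^ 2) ^ 2 := by
  classical
  obtain ⟨V, hV, hpV, h, hh, huh⟩ := hu.emitter
  set p : E3 := q • e2 with hp
  set δ := ε + q ^ 2 with hδ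
  have hδ0 : 0 < δ := by positivity
  set w : E3 → ℝ := fun x => if x = p then h p else u x - dip a p x with hw
  have hwne : ∀ x, x ≠ p → w x = u x - dip a p x := fun x hx => by simp [hw, hx]
  have hwp : w =ᶠ[nhds p] h := by
    filter_upwards [hV.mem_nhds hpV] with x hx
    by_cases hxp : x = p
    · simp [hw, hxp]
    · rw [hwne x hxp, huh x ⟨hx, hxp⟩]; ring
  have hwx : ∀ x, x ≠ p → w =ᶠ[nhds x] fun x => u x - dip a p x := fun x hx => by
    filter_upwards [isOpen_ne.mem_nhds hx] with y hy
    exact hwne y hy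
  have key : ∀ x ∈ gap ε, |w x| ≤ 16 / δ ^ 2 := by
    refine abs_le_of_harmAt_of_boundary (isOpen_gap ε) (fun x hx => ?_)
      (fun z hz η hη => ?_) (fun η hη => ?_)
    · by_cases hxp : x = p
      · rw [hxp]
        exact (hh.harmAt hV hpV).congr hwp
      · exact ((hu.harm x hx hxp).sub (harmAt_dip a p x hxp)).congr (hwx x hxp)
    · have hzp := le_norm_sub_of_notMem_gap hε hε1 hq hz
      have hzne : z ≠ p := by
        rintro rfl
        simp only [hp, sub_self, norm_zero] at hzp
        linarith
      have h1 : ContinuousAt (dip a p) z := (harmAt_dip a p z hzne).1.continuousAt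
      have h2 : |dip a p z| < 16 / δ ^ 2 + η / 2 := by
        have h3 := abs_dip_le a p z ha hzne
        have h4 : 1 / ‖z - p‖ ^ 2 ≤ 1 / (δ / 4) ^ 2 := by gcongr
        have h5 : 1 / (δ / 4) ^ 2 = 16 / δ ^ 2 := by field_simp; norm_num
        linarith
      have h6 : ∀ᶠ x in nhds z, |dip a p x| < 16 / δ ^ 2 + η / 2 :=
        h1.abs.eventually_lt_const h2
      have h7 : ∀ᶠ x in nhdsWithin z (gap ε), |u x| < η / 2 := by
        have := (hu.bdry z hz).abs
        rw [abs_zero] at this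
        exact this.eventually_lt_const (by positivity)
      filter_upwards [nhdsWithin_le_nhds h6, h7, nhdsWithin_le_nhds (isOpen_ne.mem_nhds hzne)]
        with x h8 h9 h10
      rw [hwne x h10]
      have := abs_sub (u x) (dip a p x)
      linarith
    · obtain ⟨R, hR⟩ := hu.exists_abs_le (half_pos hη)
      refine ⟨max R (‖p‖ + 1 + 2 / η), fun x _ hx => ?_⟩
      have h1 := hR x ((le_max_left _ _).trans hx)
      have h2 : ‖p‖ + 1 + 2 / η ≤ ‖x‖ := (le_max_right _ _).trans hx
      have h3 := norm_sub_norm_le x p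
      have h4 : 0 < 2 / η := by positivity
      have h5 : 1 + 2 / η ≤ ‖x - p‖ := by linarith
      have hxne : x ≠ p := by
        rintro rfl
        simp at h5
        linarith
      have h6 : 1 / ‖x - p‖ ^ 2 ≤ η / 2 := by
        have h7 : 2 / η ≤ ‖x - p‖ ^ 2 := by nlinarith
        calc 1 / ‖x - p‖ ^ 2 ≤ 1 / (2 / η) := by gcongr
          _ = η / 2 := by field_simp
      rw [hwne x hxne]
      have := abs_sub (u x) (dip a p x)
      have := abs_dip_le a p x ha hxne
      have : 0 ≤ 16 / δ ^ 2 := by positivity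
      linarith
  have h1 := key x hx
  rw [hwne x hxp] at h1
  have h2 := abs_dip_le a p x ha hxp
  have h3 := abs_sub_abs_le_abs_sub (u x) (dip a p x)
  linarith

theorem IsZeroBdrySol.abs_le_away (hu : IsZeroBdrySol ε q a u) (ha : ‖a‖ = 1) (hε : 0 < ε)
    (hε1 : ε ≤ 1) (hq : |q| ≤ 1 / 2) {x : E3} (hx : x ∈ gap ε)
    (hxp : (ε + q ^ 2) / 4 ≤ ‖x - q • e2‖) : |u x| ≤ 32 / (ε + q ^ 2) ^ 2 := by
  have hδ0 : 0 < ε + q ^ 2 := by positivity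
  have h1 := hu.abs_le_near ha hε hε1 hq hx (by
    rintro rfl
    simp at hxp
    linarith)
  have h4 : 1 / ‖x - q • e2‖ ^ 2 ≤ 1 / ((ε + q ^ 2) / 4) ^ 2 := by gcongr
  have h5 : 1 / ((ε + q ^ 2) / 4) ^ 2 = 16 / (ε + q ^ 2) ^ 2 := by field_simp; norm_num
  have h6 : 32 / (ε + q ^ 2) ^ 2 = 16 / (ε + q ^ 2) ^ 2 + 16 / (ε + q ^ 2) ^ 2 := by ring
  linarith

theorem IsZeroBdrySol.abs_le_mul_half_pow (hu : IsZeroBdrySol ε q a u) (ha : ‖a‖ = 1)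
    (hε : 0 < ε) (hε1 : ε ≤ 1) (hq : |q| ≤ 1 / 2) (hδ : ε + q ^ 2 ≤ 1 / 66) (n : ℕ)
    (hn : (ε + q ^ 2) / 4 + n * (36 * (ε + q ^ 2)) ≤ √(ε + q ^ 2)) {x : E3} (hx : x ∈ gap ε)
    (hxp : (ε + q ^ 2) / 4 + n * (36 * (ε + q ^ 2)) ≤ ‖x - q • e2‖) :
    |u x| ≤ 32 / (ε + q ^ 2) ^ 2 * (1 / 2) ^ n := by
  set p : E3 := q • e2 with hp
  set δ := ε + q ^ 2 with hδdef
  have hδ0 : 0 < δ := by positivity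
  induction n generalizing x with
  | zero =>
    simpa using hu.abs_le_away ha hε hε1 hq hx (by simpa using hxp)
  | succ n ih =>
    set s := δ / 4 + n * (36 * δ) with hs
    have hs' : δ / 4 + ((n + 1 : ℕ) : ℝ) * (36 * δ) = s + 36 * δ := by
      rw [hs]; push_cast; ring
    rw [hs'] at hn hxp
    have hs0 : 0 < s := by positivity
    have ih' : ∀ y ∈ gap ε, s ≤ ‖y - p‖ → |u y| ≤ 32 / δ ^ 2 * (1 / 2) ^ n := fun y hy h =>
      ih hy (by linarith) h
    have hne : ∀ y : E3, s ≤ ‖y - p‖ → y ≠ p := by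
      rintro y hy rfl
      simp at hy
      linarith
    have hstep : ∀ y ∈ gap ε, ‖y - p‖ = s + 36 * δ →
        |u y| ≤ 32 / δ ^ 2 * (1 / 2) ^ (n + 1) := by
      intro y hy hyp
      obtain ⟨c, hc, hyc⟩ := exists_ctr_norm_sub_le hε hε1 y
      set d := ‖y - c‖ - 1 with hd
      have hd0 : 0 < d := by have := hc y hy; rw [hd]; linarith
      have hqs : |q| ≤ √δ := Real.abs_le_sqrt (by rw [hδdef]; linarith)
      have hyn : ‖y‖ ≤ 2 * √δ := by
        have h1 := norm_sub_norm_le y p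
        rw [hp, norm_smul_e2, ← hp] at h1
        linarith
      have hyn2 : ‖y‖ ^ 2 ≤ 4 * δ := by
        calc ‖y‖ ^ 2 ≤ (2 * √δ) ^ 2 := by gcongr
          _ = 4 * δ := by rw [mul_pow, Real.sq_sqrt hδ0.le]; norm_num
      have hεδ : ε ≤ δ := by rw [hδdef]; nlinarith [sq_nonneg q]
      have hd3 : d ≤ 3 * δ := by linarith
      have hfar : ∀ w : E3, ‖w - y‖ < 33 * δ + d → s ≤ ‖w - p‖ := fun w hw => by
        have := norm_sub_le_norm_sub_add_norm_sub y w p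
        rw [norm_sub_rev y w] at this
        linarith
      have h1 := abs_le_of_exterior_ball (u := u) (y := y) (r := 33 * δ) (d := d)
        (M := 32 / δ ^ 2 * (1 / 2) ^ n) (isOpen_gap ε) hc hy (by rw [hd]; ring) hd0 (by linarith)
        (by linarith) (fun w hw h => hu.harm w hw (hne w (hfar w h))) hu.bdry
        (fun w hw h => ih' w hw (hfar w h))
      refine h1.trans ?_
      have h2 : d / (33 * δ + d) ≤ 1 / 12 := by
        rw [div_le_div_iff₀ (by linarith) (by norm_num)]
        linarith
      calc 6 * (32 / δ ^ 2 * (1 / 2) ^ n) * (d / (33 * δ + d))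
          ≤ 6 * (32 / δ ^ 2 * (1 / 2) ^ n) * (1 / 12) := by gcongr
        _ = 32 / δ ^ 2 * (1 / 2) ^ (n + 1) := by ring
    rcases hxp.lt_or_eq with hlt | heq
    · have hcn : Continuous fun x : E3 => ‖x - p‖ := by fun_prop
      refine abs_le_of_harmAt_of_boundary (U := gap ε ∩ {y | s + 36 * δ < ‖y - p‖})
        ((isOpen_gap ε).inter (isOpen_lt continuous_const hcn)) (fun y hy => ?_)
        (fun z hz η hη => ?_) (fun η hη => ?_) x ⟨hx, hlt⟩
      · refine hu.harm y hy.1 (hne y ?_)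
        have : s + 36 * δ < ‖y - p‖ := hy.2
        linarith
      · have hm : 0 ≤ 32 / δ ^ 2 * (1 / 2) ^ (n + 1) := by positivity
        by_cases hzg : z ∈ gap ε
        · have hzle : ‖z - p‖ ≤ s + 36 * δ := by
            by_contra! h
            exact hz ⟨hzg, h⟩
          rcases hzle.lt_or_eq with h | h
          · have h1 : ∀ᶠ y in nhds z, ‖y - p‖ < s + 36 * δ :=
              hcn.continuousAt.eventually_lt_const h
            filter_upwards [nhdsWithin_le_nhds h1, self_mem_nhdsWithin] with y h2 h3
            exact absurd h3.2 h2.not_gt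
          · have h1 := hstep z hzg h
            have h2 : ContinuousAt u z :=
              (hu.harm z hzg (hne z (by linarith))).1.continuousAt
            have h3 : ∀ᶠ y in nhds z, |u y| < 32 / δ ^ 2 * (1 / 2) ^ (n + 1) + η :=
              h2.abs.eventually_lt_const (by linarith)
            exact nhdsWithin_le_nhds (h3.mono fun y hy => hy.le)
        · have h1 := (hu.bdry z hzg).abs
          rw [abs_zero] at h1
          have h2 := h1.eventually_lt_const hη
          have h3 : ∀ᶠ y in nhdsWithin z (gap ε ∩ {y | s + 36 * δ < ‖y - p‖}), |u y| < η :=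
            nhdsWithin_mono z Set.inter_subset_left h2
          exact h3.mono fun y hy => by linarith
      · obtain ⟨R, hR⟩ := hu.exists_abs_le hη
        have hm : 0 ≤ 32 / δ ^ 2 * (1 / 2) ^ (n + 1) := by positivity
        exact ⟨R, fun y _ hy => by linarith [hR y hy]⟩
    · exact hstep x hx heq.symm

end

theorem div_mul_add_le_div {σ δ t : ℝ} (hσ : 0 ≤ σ) (hδ : 0 < δ) (ht : 0 ≤ t) :
    t / (σ * t + δ) ≤ t / δ := by
  gcongr
  nlinarith [mul_nonneg hσ ht]

theorem div_mul_add_le_one_div {σ δ t : ℝ} (hσ : 0 < σ) (hδ : 0 < δ) (ht : 0 ≤ t) :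
    t / (σ * t + δ) ≤ 1 / σ := by
  have := mul_nonneg hσ.le ht
  rw [div_le_div_iff₀ (by linarith) hσ]
  linarith

theorem half_div_mul_add_le {σ δ s t : ℝ} (hσ : 0 < σ) (hδ : 0 < δ) (ht : 0 ≤ t)
    (hs : t / 2 ≤ s) : t / (σ * t + δ) / 2 ≤ s / (σ * s + δ) := by
  have h1 := mul_nonneg hσ.le ht
  have h2 : 0 ≤ s := by linarith
  have h3 := mul_nonneg hσ.le h2
  rw [div_div, div_le_div_iff₀ (by linarith) (by linarith)]
  nlinarith [mul_nonneg h1 h2]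

theorem sq_quadratic_le_exp {X : ℝ} (hX : 0 ≤ X) :
    (2 * X + 32 * X ^ 2) ^ 2 ≤ (64 * 576 ^ 2) ^ 2 * exp (X / 288) := by
  have h1 := Real.quadratic_le_exp_of_nonneg (x := X / 576) (by positivity)
  have h2 : 2 * X + 32 * X ^ 2 ≤ 64 * 576 ^ 2 * exp (X / 576) := by nlinarith
  calc (2 * X + 32 * X ^ 2) ^ 2 ≤ (64 * 576 ^ 2 * exp (X / 576)) ^ 2 := by gcongr
    _ = (64 * 576 ^ 2) ^ 2 * exp (X / 288) := by
      rw [mul_pow, ← Real.exp_nat_mul]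
      congr 2
      push_cast
      ring

theorem div_le_quadratic {σ δ t : ℝ} (hσ : 0 < σ) (hδ : 0 < δ) (ht : 0 < t) (ht4 : t ≤ 4)
    (h : σ ^ 2 ≤ 2 * δ) :
    t / δ ≤ 2 * (t / (σ * t + δ)) + 32 * (t / (σ * t + δ)) ^ 2 := by
  have hσt := mul_pos hσ ht
  have hX : 0 < t / (σ * t + δ) := by positivity
  rcases le_total (σ * t) δ with h1 | h1
  · have h2 : t / (2 * δ) ≤ t / (σ * t + δ) := by
      gcongr
      linarith
    have h3 : t / (2 * δ) = t / δ / 2 := by field_simp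
    nlinarith [sq_nonneg (t / (σ * t + δ))]
  · have h2 : 1 / (2 * σ) ≤ t / (σ * t + δ) := by
      rw [div_le_div_iff₀ (by positivity) (by positivity)]
      linarith
    have h3 : t / δ ≤ 32 * (1 / (2 * σ)) ^ 2 := by
      rw [div_pow, mul_pow, ← mul_div_assoc, div_le_div_iff₀ hδ (by positivity)]
      nlinarith [sq_nonneg σ]
    have h4 : (1 / (2 * σ)) ^ 2 ≤ (t / (σ * t + δ)) ^ 2 := by gcongr
    linarith

theorem one_div_le_quadratic {σ δ t : ℝ} (hσ : 0 < σ) (hδ : 0 < δ) (h1 : δ ≤ σ * t)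
    (h : σ ^ 2 ≤ 2 * δ) (ht : 0 < t) :
    1 / δ ≤ 2 * (t / (σ * t + δ)) + 32 * (t / (σ * t + δ)) ^ 2 := by
  have hX : 0 < t / (σ * t + δ) := by positivity
  have h2 : 1 / (2 * σ) ≤ t / (σ * t + δ) := by
    rw [div_le_div_iff₀ (by positivity) (by positivity)]
    linarith
  have h3 : 1 / δ ≤ 32 * (1 / (2 * σ)) ^ 2 := by
    rw [div_pow, mul_pow, ← mul_div_assoc, div_le_div_iff₀ hδ (by positivity)]
    nlinarith [sq_nonneg σ]
  have h4 : (1 / (2 * σ)) ^ 2 ≤ (t / (σ * t + δ)) ^ 2 := by gcongr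
  linarith

theorem half_pow_le_exp (n : ℕ) : (1 / 2 : ℝ) ^ n ≤ exp (-(n / 2)) := by
  have h := Real.add_one_le_exp (-(1 / 2) : ℝ)
  calc (1 / 2 : ℝ) ^ n ≤ exp (-(1 / 2)) ^ n := by gcongr; linarith
    _ = exp (-(n / 2)) := by
      rw [← Real.exp_nat_mul]
      congr 1
      ring

theorem sqrt_add_abs_bounds {ε q : ℝ} (hε : 0 < ε) (hε1 : ε ≤ 1) (hq : |q| ≤ 1 / 2) :
    0 < √ε + |q| ∧ √ε + |q| ≤ 3 / 2 ∧ ε + q ^ 2 ≤ (√ε + |q|) ^ 2 ∧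
      (√ε + |q|) ^ 2 ≤ 2 * (ε + q ^ 2) := by
  have h1 := Real.sqrt_pos.2 hε
  have h2 := Real.sq_sqrt hε.le
  have h3 := sq_abs q
  have h4 := abs_nonneg q
  have h5 : √ε ≤ 1 := Real.sqrt_le_one.2 hε1
  refine ⟨by positivity, by linarith, by nlinarith, by nlinarith [sq_nonneg (√ε - |q|)]⟩

section

variable {ε q : ℝ} {a : E3} {u : E3 → ℝ}

theorem IsZeroBdrySol.abs_le_exp (hu : IsZeroBdrySol ε q a u) (ha : ‖a‖ = 1) (hε : 0 < ε)
    (hε1 : ε ≤ 1) (hq : |q| ≤ 1 / 2) {x : E3} (hx : x ∈ gap ε)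
    (hxp : (ε + q ^ 2) / 4 ≤ ‖x - q • e2‖) :
    |u x| ≤ 100 / (ε + q ^ 2) ^ 2 *
      exp (-(‖x - q • e2‖ / ((√ε + |q|) * ‖x - q • e2‖ + (ε + q ^ 2)) / 72)) := by
  obtain ⟨hσ, -, hδσ, -⟩ := sqrt_add_abs_bounds hε hε1 hq
  have hδ0 : 0 < ε + q ^ 2 := by positivity
  have ht : 0 ≤ ‖x - q • e2‖ := norm_nonneg _
  have hE1 := div_mul_add_le_div hσ.le hδ0 ht
  have hE2 := div_mul_add_le_one_div hσ hδ0 ht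
  set p : E3 := q • e2
  set δ := ε + q ^ 2
  set σ := √ε + |q|
  set t := ‖x - p‖
  set E := t / (σ * t + δ)
  have hsσ : √δ ≤ σ := by
    rw [← Real.sqrt_sq hσ.le]
    exact Real.sqrt_le_sqrt hδσ
  have hs0 : 0 < √δ := Real.sqrt_pos.2 hδ0
  have hs2 := Real.sq_sqrt hδ0.le
  rcases le_total δ (1 / 66) with hδ | hδ
  · set m := min t √δ
    have hsδ : δ / 4 ≤ √δ := by nlinarith
    have hm : δ / 4 ≤ m := le_min hxp hsδ
    have hEm : E ≤ m / δ := by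
      rw [le_div_iff₀ hδ0]
      refine le_min ((le_div_iff₀ hδ0).1 hE1) ?_
      have h1 : E ≤ 1 / √δ := hE2.trans (by gcongr)
      rw [le_div_iff₀ hs0] at h1
      calc E * δ = E * √δ * √δ := by rw [mul_assoc, ← sq, hs2]
        _ ≤ 1 * √δ := by gcongr
        _ = √δ := one_mul _
    set n := ⌊(m - δ / 4) / (36 * δ)⌋₊
    have hn1 : (n : ℝ) ≤ (m - δ / 4) / (36 * δ) :=
      Nat.floor_le (div_nonneg (by linarith) (by positivity))
    have hn2 : (m - δ / 4) / (36 * δ) < n + 1 := Nat.lt_floor_add_one _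
    rw [le_div_iff₀ (by positivity)] at hn1
    have hn3 : (m - δ / 4) / (36 * δ) = m / δ / 36 - 1 / 144 := by field_simp; ring
    have h1 := hu.abs_le_mul_half_pow ha hε hε1 hq hδ n
      (by linarith [min_le_right t √δ]) hx (by linarith [min_le_left t √δ])
    have h2 : exp (-(n / 2)) ≤ exp (1 + -(E / 72)) := Real.exp_le_exp.2 (by linarith)
    rw [Real.exp_add] at h2
    have h3 := Real.exp_one_lt_d9
    calc |u x| ≤ 32 / δ ^ 2 * (1 / 2) ^ n := h1
      _ ≤ 32 / δ ^ 2 * (exp 1 * exp (-(E / 72))) := by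
        gcongr
        exact (half_pow_le_exp n).trans h2
      _ = 32 * exp 1 / δ ^ 2 * exp (-(E / 72)) := by ring
      _ ≤ 100 / δ ^ 2 * exp (-(E / 72)) := by
        gcongr
        linarith
  · have h1 : 1 / 9 ≤ σ := by nlinarith
    have h2 : E ≤ 9 := hE2.trans (by rw [div_le_iff₀ hσ]; linarith)
    have h3 := Real.add_one_le_exp (-(E / 72))
    calc |u x| ≤ 32 / δ ^ 2 := hu.abs_le_away ha hε hε1 hq hx hxp
      _ = 100 / δ ^ 2 * (32 / 100) := by ring
      _ ≤ 100 / δ ^ 2 * exp (-(E / 72)) := by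
        gcongr
        linarith

theorem IsZeroBdrySol.abs_le_div_norm (hu : IsZeroBdrySol ε q a u) (hε : 0 < ε)
    (hε1 : ε ≤ 1) (hq : |q| ≤ 1 / 2) {K : ℝ} (hK : 0 ≤ K) (hb : ∀ y : E3, ‖y‖ = 3 → |u y| ≤ K)
    {y : E3} (hy : 3 ≤ ‖y‖) : |u y| ≤ 3 * K / ‖y‖ := by
  have hharm : ∀ y : E3, 3 ≤ ‖y‖ → HarmAt u y := fun y hy => by
    refine hu.harm y (mem_gap_of_three_le_norm hε hε1 hy) ?_
    rintro rfl
    rw [norm_smul_e2] at hy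
    linarith
  have hinv : ∀ y : E3, 3 ≤ ‖y‖ → HarmAt (fun y => 3 * K * (1 / ‖y - 0‖)) y := fun y hy => by
    refine (harmAt_inv_norm 0 y ?_).const_mul _
    rintro rfl
    simp at hy
    linarith
  rcases hy.lt_or_eq with hlt | heq
  swap
  · have := hb y heq.symm
    rwa [← heq, mul_div_cancel_left₀ _ (by norm_num)]
  have key : ∀ v : E3 → ℝ, (∀ y : E3, 3 ≤ ‖y‖ → HarmAt v y) → (∀ y, |v y| = |u y|) →
      v y ≤ 3 * K / ‖y‖ := by
    intro v hv hvu
    have h := le_of_harmAt_of_boundary (U := {y : E3 | 3 < ‖y‖})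
      (f := fun y => v y - 3 * K * (1 / ‖y - 0‖)) (m := 0)
      (isOpen_lt continuous_const continuous_norm)
      (fun x hx => (hv x (le_of_lt hx)).sub (hinv x (le_of_lt hx)))
      (fun z hz η hη => ?_) (fun η hη => ?_) y hlt
    · have : 3 * K * (1 / ‖y - 0‖) = 3 * K / ‖y‖ := by rw [sub_zero]; ring
      linarith
    · have hz' : ‖z‖ ≤ 3 := not_lt.1 hz
      rcases hz'.lt_or_eq with hz' | hz'
      · filter_upwards [nhdsWithin_le_nhds
          ((continuous_norm (E := E3)).continuousAt.eventually_lt_const hz'),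
          self_mem_nhdsWithin] with x h1 h2
        exact absurd h1 (not_lt.2 (le_of_lt h2))
      · have hc := ((hv z hz'.ge).sub (hinv z hz'.ge)).1.continuousAt
        have h1 : v z ≤ K := (le_abs_self _).trans ((hvu z).le.trans (hb z hz'))
        have h2 : v z - 3 * K * (1 / ‖z - 0‖) < 0 + η := by
          rw [sub_zero, hz']
          linarith
        exact nhdsWithin_le_nhds ((hc.eventually_lt_const h2).mono fun x hx => hx.le)
    · obtain ⟨R, hR⟩ := hu.exists_abs_le hη
      refine ⟨R, fun x _ hx => ?_⟩
      have h1 := (le_abs_self _).trans ((hvu x).le.trans (hR x hx))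
      have h2 : 0 ≤ 3 * K * (1 / ‖x - 0‖) := by positivity
      linarith
  rw [abs_le']
  exact ⟨key u hharm fun _ => rfl, key (fun y => -u y) (fun y hy => (hharm y hy).neg)
    fun y => abs_neg _⟩

/-- The gradient bound when the point is much closer to the emitter than the inclusions are. -/
theorem IsZeroBdrySol.norm_gradient_le_near (hu : IsZeroBdrySol ε q a u) (ha : ‖a‖ = 1)
    (hε : 0 < ε) (hε1 : ε ≤ 1) (hq : |q| ≤ 1 / 2) {x : E3} (hx : x ∈ gap ε) (hxp : x ≠ q • e2)
    (ht : ‖x - q • e2‖ ≤ (ε + q ^ 2) / 2) :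
    ‖gradient u x‖ ≤ 25000 / ‖x - q • e2‖ ^ 3 := by
  have hδ0 : 0 < ε + q ^ 2 := by positivity
  have hq2 : q ^ 2 ≤ 1 / 4 := by nlinarith [sq_abs q, abs_nonneg q]
  have ht0 : 0 < ‖x - q • e2‖ := norm_pos_iff.2 (sub_ne_zero.2 hxp)
  set p : E3 := q • e2
  set δ := ε + q ^ 2
  set t := ‖x - p‖
  have hfar : ∀ y : E3, ‖y - x‖ < t / 2 → t / 2 ≤ ‖y - p‖ := fun y hy => by
    have := norm_sub_le_norm_sub_add_norm_sub x y p
    rw [norm_sub_rev x y] at this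
    linarith
  have hne : ∀ y : E3, ‖y - x‖ < t / 2 → y ≠ p := by
    rintro y hy rfl
    have := hfar _ hy
    simp at this
    linarith
  have h := norm_gradient_le_of_two_balls (u := u) (ρ := t / 2) (M := 20 / t ^ 2)
    (fun x => mem_gap) hx (by positivity) (by linarith)
    (fun y hy h => hu.harm y hy (hne y h)) hu.bdry (fun y hy h => by
      refine (hu.abs_le_near ha hε hε1 hq hy (hne y h)).trans ?_
      have h1 : 1 / ‖y - p‖ ^ 2 ≤ 1 / (t / 2) ^ 2 := by
        have := hfar y h
        gcongr
      have h2 : 16 / δ ^ 2 ≤ 16 / (2 * t) ^ 2 := by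
        gcongr
        linarith
      have h3 : 1 / (t / 2) ^ 2 + 16 / (2 * t) ^ 2 = 8 / t ^ 2 := by field_simp; norm_num
      have h4 : 8 / t ^ 2 ≤ 20 / t ^ 2 := by gcongr; norm_num
      change 1 / ‖y - p‖ ^ 2 + 16 / δ ^ 2 ≤ 20 / t ^ 2
      linarith)
  refine h.trans ?_
  rw [show 432 * (20 / t ^ 2) / (t / 2) = 17280 / t ^ 3 by field_simp; norm_num]
  gcongr
  norm_num

/-- The gradient bound at intermediate distances. -/
theorem IsZeroBdrySol.norm_gradient_le_middle (hu : IsZeroBdrySol ε q a u) (ha : ‖a‖ = 1)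
    (hε : 0 < ε) (hε1 : ε ≤ 1) (hq : |q| ≤ 1 / 2) {x : E3} (hx : x ∈ gap ε)
    (ht : (ε + q ^ 2) / 2 ≤ ‖x - q • e2‖) (ht4 : ‖x - q • e2‖ ≤ 4) :
    ‖gradient u x‖ ≤ 172800 * (64 * 576 ^ 2) ^ 2 / ‖x - q • e2‖ ^ 3 *
      exp (-(‖x - q • e2‖ / ((√ε + |q|) * ‖x - q • e2‖ + (ε + q ^ 2)) / 288)) := by
  obtain ⟨hσ, -, -, hσδ⟩ := sqrt_add_abs_bounds hε hε1 hq
  have hδ0 : 0 < ε + q ^ 2 := by positivity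
  have ht0 : 0 < ‖x - q • e2‖ := by linarith
  have hdec := fun (y : E3) hy h => hu.abs_le_exp ha hε hε1 hq (x := y) hy h
  have hq1 := div_le_quadratic hσ hδ0 ht0 ht4 hσδ
  set p : E3 := q • e2
  set δ := ε + q ^ 2
  set σ := √ε + |q|
  set t := ‖x - p‖
  have hE0 : 0 ≤ t / (σ * t + δ) := by positivity
  have hfar : ∀ y : E3, ‖y - x‖ < t / 4 → 3 / 4 * t ≤ ‖y - p‖ := fun y hy => by
    have := norm_sub_le_norm_sub_add_norm_sub x y p
    rw [norm_sub_rev x y] at this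
    linarith
  have h := norm_gradient_le_of_two_balls (u := u) (ρ := t / 4)
    (M := 100 / δ ^ 2 * exp (-(t / (σ * t + δ) / 144)))
    (fun x => mem_gap) hx (by positivity) (by linarith)
    (fun y hy h => hu.harm y hy (by
      intro hyp
      have := hfar y h
      rw [hyp, sub_self, norm_zero] at this
      linarith)) hu.bdry (fun y hy h => by
      have h1 := hfar y h
      refine (hdec y hy (by linarith)).trans ?_
      have h2 := half_div_mul_add_le hσ hδ0 ht0.le (s := ‖y - p‖) (by linarith)
      gcongr 100 / δ ^ 2 * exp ?_
      linarith)
  have hsq : (t / δ) ^ 2 ≤ (64 * 576 ^ 2) ^ 2 * exp (t / (σ * t + δ) / 288) :=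
    le_trans (by gcongr) (sq_quadratic_le_exp hE0)
  set E := t / (σ * t + δ)
  calc ‖gradient u x‖ ≤ 432 * (100 / δ ^ 2 * exp (-(E / 144))) / (t / 4) := h
    _ = 172800 / t ^ 3 * (t / δ) ^ 2 * exp (-(E / 144)) := by field_simp; norm_num
    _ ≤ 172800 / t ^ 3 * ((64 * 576 ^ 2) ^ 2 * exp (E / 288)) * exp (-(E / 144)) := by gcongr
    _ = 172800 * (64 * 576 ^ 2) ^ 2 / t ^ 3 * (exp (E / 288) * exp (-(E / 144))) := by ring
    _ = 172800 * (64 * 576 ^ 2) ^ 2 / t ^ 3 * exp (-(E / 288)) := by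
      rw [← Real.exp_add]
      congr 2
      ring

/-- The gradient bound far away from the emitter. -/
theorem IsZeroBdrySol.norm_gradient_le_far (hu : IsZeroBdrySol ε q a u) (ha : ‖a‖ = 1)
    (hε : 0 < ε) (hε1 : ε ≤ 1) (hq : |q| ≤ 1 / 2) {x : E3} (ht : 4 ≤ ‖x - q • e2‖) :
    ‖gradient u x‖ ≤ 172800 * (64 * 576 ^ 2) ^ 2 / ‖x - q • e2‖ ^ 2 *
      exp (-(‖x - q • e2‖ / ((√ε + |q|) * ‖x - q • e2‖ + (ε + q ^ 2)) / 288)) := by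
  obtain ⟨hσ, hσ1, hδσ, hσδ⟩ := sqrt_add_abs_bounds hε hε1 hq
  have hδ0 : 0 < ε + q ^ 2 := by positivity
  have hq2 : q ^ 2 ≤ 1 / 4 := by nlinarith [sq_abs q, abs_nonneg q]
  have ht0 : 0 < ‖x - q • e2‖ := by linarith
  have hdec := fun (y : E3) hy h => hu.abs_le_exp ha hε hε1 hq (x := y) hy h
  have hpn : ‖q • e2‖ ≤ 1 / 2 := (norm_smul_e2 q).trans_le hq
  have hq1 := one_div_le_quadratic hσ hδ0 (by nlinarith) hσδ ht0
  have hE2 := div_mul_add_le_one_div hσ hδ0 ht0.le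
  set p : E3 := q • e2
  set δ := ε + q ^ 2
  set σ := √ε + |q|
  set t := ‖x - p‖
  have hE0 : 0 ≤ t / (σ * t + δ) := by positivity
  set K := 100 / δ ^ 2 * exp (-(t / (σ * t + δ) / 144)) with hK
  have hK0 : 0 ≤ K := by positivity
  have hb : ∀ y : E3, ‖y‖ = 3 → |u y| ≤ K := fun y hy => by
    have h1 := norm_sub_norm_le y p
    refine (hdec y (mem_gap_of_three_le_norm hε hε1 hy.ge) (by linarith)).trans ?_
    have h2 : 1 / (2 * σ) ≤ ‖y - p‖ / (σ * ‖y - p‖ + δ) := by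
      rw [div_le_div_iff₀ (by positivity) (by positivity)]
      nlinarith
    have h3 : 1 / (2 * σ) = 1 / σ / 2 := by field_simp
    rw [hK]
    gcongr 100 / δ ^ 2 * exp ?_
    linarith
  have hy : ∀ y ∈ ball x (t / 16), 3 ≤ ‖y‖ ∧ t / 2 ≤ ‖y‖ := fun y hy => by
    rw [mem_ball, dist_eq_norm] at hy
    have h1 := norm_sub_le x p
    have h2 := norm_sub_norm_le x (x - y)
    rw [sub_sub_cancel, norm_sub_rev x y] at h2
    constructor <;> linarith
  have h := norm_gradient_le_of_ball (u := u) (x0 := x) (d := t / 16) (M := 6 * K / t)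
    (by positivity) (fun y hyb => hu.harm y (mem_gap_of_three_le_norm hε hε1 (hy y hyb).1) (by
      rintro rfl
      linarith [(hy _ hyb).1])) (fun y hyb => by
      obtain ⟨h1, h2⟩ := hy y hyb
      refine (hu.abs_le_div_norm hε hε1 hq hK0 hb h1).trans ?_
      calc 3 * K / ‖y‖ ≤ 3 * K / (t / 2) := by gcongr
        _ = 6 * K / t := by field_simp; ring)
  have hsq : (1 / δ) ^ 2 ≤ (64 * 576 ^ 2) ^ 2 * exp (t / (σ * t + δ) / 288) :=
    le_trans (by gcongr) (sq_quadratic_le_exp hE0)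
  set E := t / (σ * t + δ)
  calc ‖gradient u x‖ ≤ 12 * (6 * K / t) / (t / 16) := h
    _ = 115200 / t ^ 2 * (1 / δ) ^ 2 * exp (-(E / 144)) := by rw [hK]; field_simp; norm_num
    _ ≤ 172800 / t ^ 2 * ((64 * 576 ^ 2) ^ 2 * exp (E / 288)) * exp (-(E / 144)) := by
      gcongr
      norm_num
    _ = 172800 * (64 * 576 ^ 2) ^ 2 / t ^ 2 * (exp (E / 288) * exp (-(E / 144))) := by ring
    _ = 172800 * (64 * 576 ^ 2) ^ 2 / t ^ 2 * exp (-(E / 288)) := by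
      rw [← Real.exp_add]
      congr 2
      ring

theorem IsZeroBdrySol.norm_gradient_le (hu : IsZeroBdrySol ε q a u) (ha : ‖a‖ = 1)
    (hε : 0 < ε) (hε1 : ε ≤ 1) (hq : |q| ≤ 1 / 2) {x : E3} (hx : x ∈ gap ε) (hxp : x ≠ q • e2) :
    ‖gradient u x‖ ≤ 172800 * (64 * 576 ^ 2) ^ 2 *
      (1 / ‖x - q • e2‖ ^ 3 + 1 / ‖x - q • e2‖ ^ 2) *
      exp (-(‖x - q • e2‖ / ((√ε + |q|) * ‖x - q • e2‖ + (ε + q ^ 2)) / 288)) := by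
  have ht0 : 0 < ‖x - q • e2‖ := norm_pos_iff.2 (sub_ne_zero.2 hxp)
  obtain ⟨hσ, -, -, -⟩ := sqrt_add_abs_bounds hε hε1 hq
  have hδ0 : 0 < ε + q ^ 2 := by positivity
  have hnear := hu.norm_gradient_le_near ha hε hε1 hq hx hxp
  have hmiddle := hu.norm_gradient_le_middle ha hε hε1 hq hx
  have hfar := hu.norm_gradient_le_far ha hε hε1 hq (x := x)
  have hE1 := div_mul_add_le_div hσ.le hδ0 ht0.le
  set t := ‖x - q • e2‖
  set E := t / ((√ε + |q|) * t + (ε + q ^ 2))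
  have h3 : (0 : ℝ) ≤ 1 / t ^ 3 := by positivity
  have h2 : (0 : ℝ) ≤ 1 / t ^ 2 := by positivity
  rcases le_total t ((ε + q ^ 2) / 2) with h | h
  · have hE : E ≤ 1 := hE1.trans (by rw [div_le_one hδ0]; linarith)
    have he : 1 / 2 ≤ exp (-(E / 288)) := by linarith [Real.add_one_le_exp (-(E / 288))]
    calc ‖gradient u x‖ ≤ 25000 / t ^ 3 := hnear h
      _ = 50000 * (1 / t ^ 3) * (1 / 2) := by ring
      _ ≤ 172800 * (64 * 576 ^ 2) ^ 2 * (1 / t ^ 3 + 1 / t ^ 2) * exp (-(E / 288)) := by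
        gcongr
        · norm_num
        · linarith
  · rcases le_total t 4 with h4 | h4
    · refine (hmiddle h h4).trans ?_
      rw [div_eq_mul_one_div _ (t ^ 3)]
      gcongr
      linarith
    · refine (hfar h4).trans ?_
      rw [div_eq_mul_one_div _ (t ^ 2)]
      gcongr
      linarith

end
/-- Lemma 4.1: gradient estimate for the solution `r₀` with zero boundary values. -/
theorem stmt9 :
    ∃ A ε₀ c : ℝ, 0 < A ∧ 0 < ε₀ ∧ 0 < c ∧
    ∀ a : E3, ‖a‖ = 1 →
    ∀ ε p₃ : ℝ, 0 < ε → ε ≤ ε₀ → |p₃| ≤ 1 / 2 →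
    ∀ r₀ : E3 → ℝ,
      IsHarmonicOn r₀ (closure (D1 ε ∪ D2 ε) ∪ {p₃ • e2})ᶜ →
      (∃ V : Set E3, IsOpen V ∧ p₃ • e2 ∈ V ∧ ∃ h : E3 → ℝ, IsHarmonicOn h V ∧
        ∀ x ∈ V \ {p₃ • e2}, r₀ x = dip a (p₃ • e2) x + h x) →
      (∀ x ∈ Metric.sphere (ctr1 ε) 1 ∪ Metric.sphere (ctr2 ε) 1,
        Filter.Tendsto r₀ (nhdsWithin x (closure (D1 ε ∪ D2 ε))ᶜ) (nhds 0)) →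
      (∃ C R : ℝ, ∀ x : E3, R ≤ ‖x‖ → |r₀ x| ≤ C / ‖x‖) →
      ∀ x : E3, x ∉ closure (D1 ε ∪ D2 ε) → x ≠ p₃ • e2 →
        ‖gradient r₀ x‖ ≤ c * (1 / ‖x - p₃ • e2‖ ^ 3 + 1 / ‖x - p₃ • e2‖ ^ 2) *
          Real.exp (-(A * ‖x - p₃ • e2‖ /
            ((Real.sqrt ε + |p₃|) * ‖x - p₃ • e2‖ + ε + |p₃| ^ 2))) := by
  refine ⟨1 / 288, 1, 172800 * (64 * 576 ^ 2) ^ 2, by norm_num, by norm_num, by norm_num,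
    fun a ha ε q hε hε1 hq u harm emitter bdry decay x hx hxp => ?_⟩
  refine ((IsZeroBdrySol.of_hypotheses harm emitter bdry decay).norm_gradient_le
    ha hε hε1 hq hx hxp).trans_eq ?_
  rw [sq_abs, add_assoc]
  ring_nf
end
end

section
/- There is a universal constant C > 0 with the following property. Let w be a function that is harmonic on an open set containing {x ∈ ℝ³ : |x| ≥ 3} and satisfies w(x) = O(|x|⁻²) as |x| → ∞. Then for every x with |x| > 4, |∇w(x)| ≤ C ‖∇w‖_{L²(∂B₃)} |x|⁻³, where ‖∇w‖_{L²(∂B₃)} is the L² norm of |∇w| with respect to the surface measure on the sphere of radius 3 centered at the origin. -/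
open MeasureTheory Metric Real Filter
open scoped RealInnerProductSpace

noncomputable section

/-- The `i`-th partial derivative. -/
def pd (i : Fin 3) (f : E3 → ℝ) (x : E3) : ℝ := fderiv ℝ f x (EuclideanSpace.single i 1)

theorem integrable_mul_of_tsupport_subset {ζ g : E3 → ℝ} {s : Set E3}
    (hs : IsOpen s) (hζ : Continuous ζ) (hc : HasCompactSupport ζ) (hsub : tsupport ζ ⊆ s)
    (hg : ContinuousOn g s) : Integrable (fun x => ζ x * g x) := by
  refine Continuous.integrable_of_hasCompactSupport ?_ hc.mul_right
  refine continuous_of_tsupport fun x hx => ?_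
  exact hζ.continuousAt.mul
    (hg.continuousAt (hs.mem_nhds (hsub (tsupport_mul_subset_left hx))))

theorem continuous_pd {f : E3 → ℝ} (hf : ContDiff ℝ 1 f) (i : Fin 3) : Continuous (pd i f) :=
  (hf.continuous_fderiv one_ne_zero).clm_apply continuous_const

theorem continuousOn_pd {f : E3 → ℝ} {s : Set E3} (hs : IsOpen s) (hf : ContDiffOn ℝ 1 f s)
    (i : Fin 3) : ContinuousOn (pd i f) s :=
  (hf.continuousOn_fderiv_of_isOpen hs le_rfl).clm_apply continuousOn_const

theorem contDiffOn_pd {f : E3 → ℝ} {s : Set E3} (hs : IsOpen s) (hf : ContDiffOn ℝ 2 f s)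
    (i : Fin 3) : ContDiffOn ℝ 1 (pd i f) s :=
  (hf.fderiv_of_isOpen hs (by norm_num)).clm_apply contDiffOn_const

theorem contDiff_pd {f : E3 → ℝ} (hf : ContDiff ℝ 2 f) (i : Fin 3) : ContDiff ℝ 1 (pd i f) :=
  (hf.fderiv_right (by norm_num)).clm_apply contDiff_const

theorem pd_mul {f g : E3 → ℝ} {x : E3} (hf : DifferentiableAt ℝ f x)
    (hg : DifferentiableAt ℝ g x) (i : Fin 3) :
    pd i (fun y => f y * g y) x = pd i f x * g x + f x * pd i g x := by
  simp only [pd]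
  rw [fderiv_fun_mul hf hg]
  simp
  ring

theorem tsupport_pd_subset (f : E3 → ℝ) (i : Fin 3) : tsupport (pd i f) ⊆ tsupport f :=
  tsupport_fderiv_apply_subset ℝ (f := f) (EuclideanSpace.single i 1)

theorem hasCompactSupport_pd {f : E3 → ℝ} (hf : HasCompactSupport f) (i : Fin 3) :
    HasCompactSupport (pd i f) :=
  hf.mono' ((subset_tsupport _).trans (tsupport_pd_subset f i))

/-- Integration by parts against a test function supported in an open set. -/
theorem integral_mul_pd {ζ g : E3 → ℝ} {s : Set E3} (hs : IsOpen s) (hζ : ContDiff ℝ 1 ζ)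
    (hc : HasCompactSupport ζ) (hsub : tsupport ζ ⊆ s) (hg : ContDiffOn ℝ 1 g s) (i : Fin 3) :
    ∫ x, ζ x * pd i g x = -∫ x, pd i ζ x * g x := by
  have h3 := integrable_mul_of_tsupport_subset hs hζ.continuous hc hsub hg.continuousOn
  refine integral_mul_fderiv_eq_neg_fderiv_mul_of_integrable ?_ ?_ h3
    (fun x _ => hζ.differentiable one_ne_zero x) ?_
  · exact integrable_mul_of_tsupport_subset hs (continuous_pd hζ i) (hasCompactSupport_pd hc i)
      ((tsupport_pd_subset ζ i).trans hsub) hg.continuousOn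
  · exact integrable_mul_of_tsupport_subset hs hζ.continuous hc hsub (continuousOn_pd hs hg i)
  · intro x hx
    exact (hg.differentiableOn one_ne_zero).differentiableAt (hs.mem_nhds (hsub hx))

/-- The divergence identity for the stress tensor of two irrotational fields, the first of which is
solenoidal, tested against `ζ`. -/
theorem integral_mul_div_eq {ζ : E3 → ℝ} {F ψ : Fin 3 → E3 → ℝ} {s : Set E3} (hs : IsOpen s)
    (hζ : ContDiff ℝ 1 ζ) (hc : HasCompactSupport ζ) (hsub : tsupport ζ ⊆ s)
    (hF : ∀ i, ContDiffOn ℝ 1 (F i) s) (hψ : ∀ i, ContDiff ℝ 1 (ψ i))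
    (hFc : ∀ i j, ∀ x ∈ s, pd i (F j) x = pd j (F i) x) (hFd : ∀ x ∈ s, ∑ i, pd i (F i) x = 0)
    (hψc : ∀ i j x, pd i (ψ j) x = pd j (ψ i) x) (k : Fin 3) :
    ∫ x, ζ x * (F k x * ∑ j, pd j (ψ j) x) =
      ∑ j, ((∫ x, pd k ζ x * (ψ j x * F j x)) - (∫ x, pd j ζ x * (ψ j x * F k x)) -
        ∫ x, pd j ζ x * (ψ k x * F j x)) := by
  have hP : ∀ i j, ContDiffOn ℝ 1 (fun x => ψ i x * F j x) s := fun i j =>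
    (hψ i).contDiffOn.mul (hF j)
  have hI : ∀ i j l, Integrable (fun x => ζ x * pd l (fun x => ψ i x * F j x) x) := fun i j l =>
    integrable_mul_of_tsupport_subset hs hζ.continuous hc hsub (continuousOn_pd hs (hP i j) l)
  have hI2 : ∀ j, Integrable (fun x => ζ x * pd j (fun x => ψ j x * F k x) x +
      ζ x * pd j (fun x => ψ k x * F j x) x) := fun j => (hI j k j).add (hI k j j)
  have hI3 : ∀ j, Integrable (fun x => ζ x * pd j (fun x => ψ j x * F k x) x +
      ζ x * pd j (fun x => ψ k x * F j x) x - ζ x * pd k (fun x => ψ j x * F j x) x) :=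
    fun j => (hI2 j).sub (hI j j k)
  have hrhs : ∀ i j l, ∫ x, pd l ζ x * (ψ i x * F j x) =
      -∫ x, ζ x * pd l (fun x => ψ i x * F j x) x := by
    intro i j l
    rw [integral_mul_pd hs hζ hc hsub (hP i j) l, neg_neg]
  simp only [hrhs]
  have : ∀ j, (-(∫ x, ζ x * pd k (fun x => ψ j x * F j x) x) -
      -(∫ x, ζ x * pd j (fun x => ψ j x * F k x) x) -
      -∫ x, ζ x * pd j (fun x => ψ k x * F j x) x) =
      ∫ x, (ζ x * pd j (fun x => ψ j x * F k x) x + ζ x * pd j (fun x => ψ k x * F j x) x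
        - ζ x * pd k (fun x => ψ j x * F j x) x) := by
    intro j
    rw [integral_sub (hI2 j) (hI j j k), integral_add (hI j k j) (hI k j j)]
    ring
  simp only [this]
  rw [← integral_finsetSum _ fun j _ => hI3 j]
  congr 1
  ext x
  by_cases hx : x ∈ tsupport ζ
  · have hxs := hsub hx
    have dF : ∀ i, DifferentiableAt ℝ (F i) x := fun i =>
      ((hF i).differentiableOn one_ne_zero).differentiableAt (hs.mem_nhds hxs)
    have dψ : ∀ i, DifferentiableAt ℝ (ψ i) x := fun i => (hψ i).differentiable one_ne_zero x
    simp only [fun i j l => pd_mul (dψ i) (dF j) l]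
    have h1 := hFd x hxs
    simp only [Fin.sum_univ_three] at h1 ⊢
    rw [hFc k 0 x hxs, hFc k 1 x hxs, hFc k 2 x hxs, hψc k 0, hψc k 1, hψc k 2]
    linear_combination (-ζ x * ψ k x) * h1
  · simp [image_eq_zero_of_notMem_tsupport hx]

theorem abs_integral_mul_div_le {ζ : E3 → ℝ} {F ψ : Fin 3 → E3 → ℝ} {s : Set E3} (hs : IsOpen s)
    (hζ : ContDiff ℝ 1 ζ) (hc : HasCompactSupport ζ) (hsub : tsupport ζ ⊆ s)
    (hF : ∀ i, ContDiffOn ℝ 1 (F i) s) (hψ : ∀ i, ContDiff ℝ 1 (ψ i))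
    (hFc : ∀ i j, ∀ x ∈ s, pd i (F j) x = pd j (F i) x) (hFd : ∀ x ∈ s, ∑ i, pd i (F i) x = 0)
    (hψc : ∀ i j x, pd i (ψ j) x = pd j (ψ i) x) {B : ℝ}
    (hB : ∀ i j l, |∫ x, pd i ζ x * (ψ j x * F l x)| ≤ B) (k : Fin 3) :
    |∫ x, ζ x * (F k x * ∑ j, pd j (ψ j) x)| ≤ 9 * B := by
  rw [integral_mul_div_eq hs hζ hc hsub hF hψ hFc hFd hψc k]
  refine (Finset.abs_sum_le_sum_abs _ _).trans ?_
  refine (Finset.sum_le_card_nsmul _ _ (3 * B) fun j _ => ?_).trans (by simp; linarith)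
  refine (abs_sub _ _).trans ((add_le_add_left (abs_sub _ _) _).trans ?_)
  linarith [hB k j j, hB j j k, hB j k j]

/-- The mixed partial derivatives of a `C²` function agree. -/
theorem pd_pd_comm {f : E3 → ℝ} {s : Set E3} (hs : IsOpen s) (hf : ContDiffOn ℝ 2 f s)
    (i j : Fin 3) {x : E3} (hx : x ∈ s) : pd i (pd j f) x = pd j (pd i f) x := by
  have hd : DifferentiableAt ℝ (fderiv ℝ f) x :=
    ((hf.fderiv_of_isOpen hs (by norm_num : (1 : WithTop ℕ∞) + 1 ≤ 2)).differentiableOn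
      one_ne_zero).differentiableAt (hs.mem_nhds hx)
  have key : ∀ a b : Fin 3, pd a (pd b f) x =
      fderiv ℝ (fderiv ℝ f) x (EuclideanSpace.single a 1) (EuclideanSpace.single b 1) := by
    intro a b
    have : pd b f = fun y => fderiv ℝ f y (EuclideanSpace.single b 1) := rfl
    rw [this, pd, fderiv_clm_apply hd (differentiableAt_const _)]
    simp
  rw [key, key]
  exact ((hf.contDiffAt (hs.mem_nhds hx)).isSymmSndFDerivAt (by simp)).eq _ _

/-- The reciprocal of `√(‖z - x‖² + δ²)`. -/
def regInv (x : E3) (δ : ℝ) (z : E3) : ℝ := (√(‖z - x‖ ^ 2 + δ ^ 2))⁻¹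

/-- The components of the gradient of the regularized Newtonian potential
`-(‖z - x‖² + δ²)^(-1/2)`. -/
def regKernel (x : E3) (δ : ℝ) (j : Fin 3) (z : E3) : ℝ := (z j - x j) * regInv x δ z ^ 3

theorem regInv_pos {δ : ℝ} (hδ : 0 < δ) (x z : E3) : 0 < regInv x δ z := by
  unfold regInv; positivity

theorem norm_mul_regInv_le (x : E3) (δ : ℝ) (z : E3) : ‖z - x‖ * regInv x δ z ≤ 1 := by
  unfold regInv
  have h : ‖z - x‖ ≤ √(‖z - x‖ ^ 2 + δ ^ 2) := Real.le_sqrt_of_sq_le (by nlinarith [sq_nonneg δ])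
  exact mul_inv_le_one_of_le₀ h (by positivity)

theorem regInv_le_inv (x : E3) (δ : ℝ) {z : E3} {r : ℝ} (hr : 0 < r) (h : r ≤ ‖z - x‖) :
    regInv x δ z ≤ r⁻¹ := by
  unfold regInv
  gcongr
  exact Real.le_sqrt_of_sq_le (by nlinarith [sq_nonneg δ])

theorem regInv_sq {δ : ℝ} (hδ : 0 < δ) (x z : E3) :
    regInv x δ z ^ 2 * (‖z - x‖ ^ 2 + δ ^ 2) = 1 := by
  unfold regInv
  have : 0 < ‖z - x‖ ^ 2 + δ ^ 2 := by positivity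
  rw [inv_pow, Real.sq_sqrt this.le]
  field_simp

theorem contDiff_regKernel {δ : ℝ} (hδ : 0 < δ) (x : E3) (j : Fin 3) (n : WithTop ℕ∞) :
    ContDiff ℝ n (regKernel x δ j) := by
  have h1 : ContDiff ℝ n (regInv x δ) := by
    unfold regInv
    refine ContDiff.inv (ContDiff.sqrt ?_ fun z => by positivity) fun z => by positivity
    exact ((contDiff_id.sub contDiff_const).norm_sq ℝ).add contDiff_const
  have h2 : ContDiff ℝ n (fun z : E3 => z j) := contDiff_piLp_apply 2
  exact (h2.sub contDiff_const).mul (h1.pow 3)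

theorem hasFDerivAt_regKernel {δ : ℝ} (hδ : 0 < δ) (x z : E3) (j : Fin 3) :
    HasFDerivAt (regKernel x δ j)
      (regInv x δ z ^ 3 • EuclideanSpace.proj (𝕜 := ℝ) j -
        (3 * regInv x δ z ^ 5 * (z j - x j)) • innerSL ℝ (z - x)) z := by
  have hp : 0 < ‖z - x‖ ^ 2 + δ ^ 2 := by positivity
  have h1 : HasFDerivAt (fun z : E3 => ‖z - x‖ ^ 2 + δ ^ 2) (2 • innerSL ℝ (z - x)) z := by
    have := ((hasFDerivAt_id z).sub_const x).norm_sq.add_const (δ ^ 2)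
    simpa using! this
  have h2 := ((((hasDerivAt_id _).sqrt hp.ne').inv
    (Real.sqrt_pos.2 hp).ne').pow 3).comp_hasFDerivAt z h1
  have h3 : HasFDerivAt (fun z : E3 => z j - x j) (EuclideanSpace.proj (𝕜 := ℝ) j : E3 →L[ℝ] ℝ) z :=
    (EuclideanSpace.proj (𝕜 := ℝ) j : E3 →L[ℝ] ℝ).hasFDerivAt.sub_const _
  refine (h3.mul h2).congr_fderiv ?_
  ext v
  have hs := (Real.sqrt_pos.2 hp).ne'
  simp [regInv]
  field_simp
  ring

theorem pd_regKernel {δ : ℝ} (hδ : 0 < δ) (x z : E3) (i j : Fin 3) :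
    pd i (regKernel x δ j) z = regInv x δ z ^ 3 * (if i = j then 1 else 0) -
      3 * regInv x δ z ^ 5 * ((z i - x i) * (z j - x j)) := by
  rw [pd, (hasFDerivAt_regKernel hδ x z j).fderiv]
  simp [EuclideanSpace.inner_single_right, eq_comm]
  ring

theorem pd_regKernel_comm {δ : ℝ} (hδ : 0 < δ) (x z : E3) (i j : Fin 3) :
    pd i (regKernel x δ j) z = pd j (regKernel x δ i) z := by
  rw [pd_regKernel hδ, pd_regKernel hδ]
  simp only [eq_comm (a := i)]
  ring

theorem sum_pd_regKernel {δ : ℝ} (hδ : 0 < δ) (x z : E3) :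
    ∑ j, pd j (regKernel x δ j) z = 3 * δ ^ 2 * regInv x δ z ^ 5 := by
  simp only [pd_regKernel hδ]
  have h := regInv_sq hδ x z
  rw [EuclideanSpace.real_norm_sq_eq] at h
  simp only [Fin.sum_univ_three, PiLp.sub_apply] at h ⊢
  simp
  linear_combination (-3 * regInv x δ z ^ 3) * h

theorem abs_coord_sub_le (x z : E3) (j : Fin 3) : |z j - x j| ≤ ‖z - x‖ :=
  PiLp.norm_apply_le (z - x) j

theorem norm_fderiv_regKernel_le {δ : ℝ} (hδ : 0 < δ) (x z : E3) (j : Fin 3) :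
    ‖fderiv ℝ (regKernel x δ j) z‖ ≤ 4 * regInv x δ z ^ 3 := by
  rw [(hasFDerivAt_regKernel hδ x z j).fderiv]
  have hk := regInv_pos hδ x z
  refine ContinuousLinearMap.opNorm_le_bound _ (by positivity) fun v => ?_
  have h1 : ‖v j‖ ≤ ‖v‖ := PiLp.norm_apply_le v j
  have h2 : ‖⟪z - x, v⟫‖ ≤ ‖z - x‖ * ‖v‖ := norm_inner_le_norm _ _
  have h3 := abs_coord_sub_le x z j
  have h4 := norm_mul_regInv_le x δ z
  simp only [FunLike.coe_sub, FunLike.coe_smul, Pi.sub_apply, Pi.smul_apply, smul_eq_mul,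
    innerSL_apply_apply, PiLp.proj_apply]
  refine (norm_sub_le _ _).trans ?_
  rw [norm_mul, norm_mul, norm_mul, norm_of_nonneg (by positivity : 0 ≤ regInv x δ z ^ 3),
    norm_of_nonneg (by positivity : 0 ≤ 3 * regInv x δ z ^ 5)]
  have h5 : 3 * regInv x δ z ^ 5 * ‖z j - x j‖ * ‖⟪z - x, v⟫‖ ≤
      3 * regInv x δ z ^ 5 * ‖z - x‖ * (‖z - x‖ * ‖v‖) := by gcongr; exact h3
  have h6 : (‖z - x‖ * regInv x δ z) ^ 2 ≤ 1 := pow_le_one₀ (by positivity) h4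
  have h7 : 3 * regInv x δ z ^ 5 * ‖z - x‖ * (‖z - x‖ * ‖v‖) ≤ 3 * regInv x δ z ^ 3 * ‖v‖ := by
    calc _ = (3 * regInv x δ z ^ 3 * ‖v‖) * (‖z - x‖ * regInv x δ z) ^ 2 := by ring
      _ ≤ (3 * regInv x δ z ^ 3 * ‖v‖) * 1 := by gcongr
      _ = _ := by ring
  have h8 : regInv x δ z ^ 3 * ‖v j‖ ≤ regInv x δ z ^ 3 * ‖v‖ := by gcongr
  linarith

theorem abs_regKernel_le {δ : ℝ} (hδ : 0 < δ) (x z : E3) (j : Fin 3) :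
    |regKernel x δ j z| ≤ regInv x δ z ^ 2 := by
  have hk := regInv_pos hδ x z
  rw [regKernel, abs_mul, abs_of_pos (by positivity : 0 < regInv x δ z ^ 3)]
  calc _ ≤ ‖z - x‖ * regInv x δ z ^ 3 := by gcongr; exact abs_coord_sub_le x z j
    _ = (‖z - x‖ * regInv x δ z) * regInv x δ z ^ 2 := by ring
    _ ≤ 1 * regInv x δ z ^ 2 := by gcongr; exact norm_mul_regInv_le x δ z
    _ = _ := one_mul _

theorem abs_regKernel_sub_le {δ : ℝ} (hδ : 0 < δ) {x z : E3} (hx : 4 ≤ ‖x‖) (hz : ‖z‖ ≤ 7 / 2)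
    (j : Fin 3) : |regKernel x δ j z - regKernel x δ j 0| ≤ 7168 / ‖x‖ ^ 3 := by
  have hbound : ∀ y ∈ closedBall (0 : E3) (7 / 2),
      ‖fderiv ℝ (regKernel x δ j) y‖ ≤ 4 * ((‖x‖ / 8)⁻¹) ^ 3 := by
    intro y hy
    refine (norm_fderiv_regKernel_le hδ x y j).trans ?_
    have := (regInv_pos hδ x y).le
    gcongr
    refine regInv_le_inv x δ (by linarith) ?_
    rw [mem_closedBall_zero_iff] at hy
    have := norm_sub_norm_le x y
    rw [norm_sub_rev] at this
    linarith
  have := (convex_closedBall (0 : E3) (7 / 2)).norm_image_sub_le_of_norm_fderiv_le (𝕜 := ℝ)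
    (fun y _ => (hasFDerivAt_regKernel hδ x y j).differentiableAt) hbound
    (mem_closedBall_self (by norm_num)) (mem_closedBall_zero_iff.2 hz)
  refine this.trans ?_
  rw [sub_zero]
  have hx0 : 0 < ‖x‖ := by linarith
  calc _ ≤ 4 * ((‖x‖ / 8)⁻¹) ^ 3 * (7 / 2) := by gcongr
    _ = _ := by field_simp; norm_num

/-- A smooth radial cutoff, equal to `0` for `‖z‖ ≤ A` and to `1` for `‖z‖ ≥ A + B`. -/
def cut (A B : ℝ) (z : E3) : ℝ := smoothTransition ((‖z‖ - A) / B)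

theorem cut_eq_zero {A B : ℝ} (hB : 0 < B) {z : E3} (h : ‖z‖ ≤ A) : cut A B z = 0 :=
  smoothTransition.zero_of_nonpos (div_nonpos_of_nonpos_of_nonneg (by linarith) hB.le)

theorem cut_eq_one {A B : ℝ} (hB : 0 < B) {z : E3} (h : A + B ≤ ‖z‖) : cut A B z = 1 :=
  smoothTransition.one_of_one_le ((one_le_div hB).2 (by linarith))

theorem cut_scale {R : ℝ} (hR : 0 < R) (z : E3) : cut R R z = cut 1 1 (R⁻¹ • z) := by
  unfold cut
  rw [norm_smul, Real.norm_of_nonneg (by positivity)]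
  congr 1
  field_simp

theorem contDiff_cut {A B : ℝ} (hA : 0 < A) (hB : 0 < B) (n : ℕ∞) : ContDiff ℝ n (cut A B) := by
  refine contDiff_iff_contDiffAt.2 fun z => ?_
  by_cases hz : z = 0
  · have h : cut A B =ᶠ[nhds z] fun _ => 0 := by
      filter_upwards [isOpen_ball.mem_nhds (by simpa [hz] using hA : z ∈ ball (0 : E3) A)] with y hy
      exact cut_eq_zero hB (by simpa using (mem_ball_zero_iff.1 hy).le)
    exact contDiffAt_const.congr_of_eventuallyEq h
  · exact smoothTransition.contDiff.contDiffAt.comp z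
      (((contDiffAt_norm ℝ hz).sub contDiffAt_const).div_const B)

theorem deriv_smoothTransition_nonneg (t : ℝ) : 0 ≤ deriv smoothTransition t :=
  smoothTransition.monotone.deriv_nonneg

theorem deriv_smoothTransition_of_nonpos {t : ℝ} (h : t ≤ 0) : deriv smoothTransition t = 0 := by
  refine IsLocalMin.deriv_eq_zero (Eventually.of_forall fun y => ?_)
  rw [smoothTransition.zero_of_nonpos h]
  exact smoothTransition.nonneg y

theorem deriv_smoothTransition_of_one_le {t : ℝ} (h : 1 ≤ t) : deriv smoothTransition t = 0 := by
  refine IsLocalMax.deriv_eq_zero (Eventually.of_forall fun y => ?_)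
  rw [smoothTransition.one_of_one_le h]
  exact smoothTransition.le_one y

theorem continuous_deriv_smoothTransition : Continuous (deriv smoothTransition) :=
  (smoothTransition.contDiff (n := 1)).continuous_deriv le_rfl

theorem abs_pd_le (i : Fin 3) (f : E3 → ℝ) (z : E3) : |pd i f z| ≤ ‖fderiv ℝ f z‖ := by
  have := (fderiv ℝ f z).le_opNorm (EuclideanSpace.single i 1)
  simpa [pd] using this

/-- The radial profile of the gradient of `cut A B`. -/
def cutDeriv (A B r : ℝ) : ℝ := deriv smoothTransition ((r - A) / B) / B

theorem continuous_cutDeriv (A B : ℝ) : Continuous (cutDeriv A B) :=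
  (continuous_deriv_smoothTransition.comp (by fun_prop)).div_const B

theorem cutDeriv_nonneg {A B : ℝ} (hB : 0 < B) (r : ℝ) : 0 ≤ cutDeriv A B r :=
  div_nonneg (deriv_smoothTransition_nonneg _) hB.le

theorem cutDeriv_eq_zero {A B r : ℝ} (hB : 0 < B) (h : r ≤ A ∨ A + B ≤ r) :
    cutDeriv A B r = 0 := by
  unfold cutDeriv
  rcases h with h | h
  · rw [deriv_smoothTransition_of_nonpos, zero_div]
    exact div_nonpos_of_nonpos_of_nonneg (by linarith) hB.le
  · rw [deriv_smoothTransition_of_one_le, zero_div]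
    exact (one_le_div hB).2 (by linarith)

theorem abs_pd_cut_le {A B : ℝ} (hA : 0 < A) (hB : 0 < B) (i : Fin 3) (z : E3) :
    |pd i (cut A B) z| ≤ cutDeriv A B ‖z‖ := by
  refine (abs_pd_le i _ z).trans ?_
  by_cases hz : z = 0
  · have h : cut A B =ᶠ[nhds z] fun _ => 0 := by
      filter_upwards [isOpen_ball.mem_nhds (by simpa [hz] using hA : z ∈ ball (0 : E3) A)] with y hy
      exact cut_eq_zero hB (by simpa using (mem_ball_zero_iff.1 hy).le)
    rw [h.fderiv_eq]
    simpa using cutDeriv_nonneg hB _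
  · have h1 : HasFDerivAt (fun z : E3 => ‖z‖) (fderiv ℝ (fun z : E3 => ‖z‖) z) z :=
      ((contDiffAt_norm ℝ hz (n := 1)).differentiableAt one_ne_zero).hasFDerivAt
    have h2 : HasDerivAt (fun r => smoothTransition ((r - A) / B)) (cutDeriv A B ‖z‖) ‖z‖ := by
      have h3 : HasDerivAt smoothTransition (deriv smoothTransition ((‖z‖ - A) / B))
          ((‖z‖ - A) / B) :=
        ((smoothTransition.contDiff (n := 1)).differentiable one_ne_zero _).hasDerivAt
      have := h3.comp ‖z‖ (((hasDerivAt_id ‖z‖).sub_const A).div_const B)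
      simpa [cutDeriv, div_eq_mul_inv, Function.comp_def] using this
    have h3 := h2.comp_hasFDerivAt z h1
    have h4 : fderiv ℝ (cut A B) z = cutDeriv A B ‖z‖ • fderiv ℝ (fun z : E3 => ‖z‖) z := h3.fderiv
    rw [h4, norm_smul, Real.norm_of_nonneg (cutDeriv_nonneg hB _)]
    refine mul_le_of_le_one_right (cutDeriv_nonneg hB _) ?_
    simpa using norm_fderiv_le_of_lipschitz ℝ (lipschitzWith_one_norm (E := E3)) (x₀ := z)

theorem integral_cutDeriv_le {A B : ℝ} (hA : 0 < A) (hB : 0 < B) :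
    ∫ r in Set.Ioi (0 : ℝ), r ^ 2 * cutDeriv A B r ≤ (A + B) ^ 2 := by
  have h0 : ∀ r ∈ Set.Ioi (0 : ℝ) \ Set.Ioc 0 (A + B), r ^ 2 * cutDeriv A B r = 0 := by
    rintro r ⟨h1, h2⟩
    rw [cutDeriv_eq_zero hB, mul_zero]
    right
    by_contra! h
    exact h2 ⟨h1, h.le⟩
  rw [setIntegral_eq_of_subset_of_forall_sdiff_eq_zero measurableSet_Ioi
    Set.Ioc_subset_Ioi_self h0, ← intervalIntegral.integral_of_le (by positivity)]
  have h1 : ∫ r in (0 : ℝ)..(A + B), cutDeriv A B r = 1 := by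
    have hd : ∀ r ∈ Set.uIcc 0 (A + B),
        HasDerivAt (fun r => smoothTransition ((r - A) / B)) (cutDeriv A B r) r := by
      intro r _
      have h3 : HasDerivAt smoothTransition (deriv smoothTransition ((r - A) / B))
          ((r - A) / B) :=
        ((smoothTransition.contDiff (n := 1)).differentiable one_ne_zero _).hasDerivAt
      have := h3.comp r (((hasDerivAt_id r).sub_const A).div_const B)
      simpa [cutDeriv, div_eq_mul_inv, Function.comp_def] using this
    rw [intervalIntegral.integral_eq_sub_of_hasDerivAt hd
      ((continuous_cutDeriv A B).intervalIntegrable _ _),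
      smoothTransition.one_of_one_le (by rw [one_le_div hB]; linarith),
      smoothTransition.zero_of_nonpos
        (div_nonpos_of_nonpos_of_nonneg (by linarith) hB.le), sub_zero]
  calc ∫ r in (0 : ℝ)..(A + B), r ^ 2 * cutDeriv A B r
      ≤ ∫ r in (0 : ℝ)..(A + B), (A + B) ^ 2 * cutDeriv A B r := by
        refine intervalIntegral.integral_mono_on (by positivity) ?_ ?_ fun r hr => ?_
        · exact ((continuous_pow 2).mul (continuous_cutDeriv A B)).intervalIntegrable _ _
        · exact (continuous_const.mul (continuous_cutDeriv A B)).intervalIntegrable _ _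
        · exact mul_le_mul_of_nonneg_right (pow_le_pow_left₀ hr.1 hr.2 2) (cutDeriv_nonneg hB r)
    _ = (A + B) ^ 2 := by rw [intervalIntegral.integral_const_mul, h1, mul_one]

/-- The surface measure of the unit sphere. -/
abbrev surf : Measure (sphere (0 : E3) 1) := (volume : Measure E3).toSphere

/-- Integration in polar coordinates of a product of a radial and an angular function. -/
theorem integral_radial_mul_angular (p : ℝ → ℝ) (h : E3 → ℝ) :
    ∫ z : E3, p ‖z‖ * h (‖z‖⁻¹ • z) =
      (∫ r in Set.Ioi (0 : ℝ), r ^ 2 * p r) * ∫ u, h u ∂surf := by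
  calc
    ∫ z : E3, p ‖z‖ * h (‖z‖⁻¹ • z)
      = ∫ z : ({(0)}ᶜ : Set E3), p ‖z.1‖ * h (‖z.1‖⁻¹ • z.1)
          ∂(Measure.comap Subtype.val volume) := by
      rw [integral_subtype_comap (measurableSet_singleton _).compl
        fun z : E3 => p ‖z‖ * h (‖z‖⁻¹ • z), restrict_compl_singleton]
    _ = ∫ x, h x.1 * p x.2 ∂surf.prod (.volumeIoiPow (Module.finrank ℝ E3 - 1)) := by
      have := (volume : Measure E3).measurePreserving_homeomorphUnitSphereProd.integral_comp
        (Homeomorph.measurableEmbedding _)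
        (fun x : sphere (0 : E3) 1 × Set.Ioi (0 : ℝ) => h x.1 * p x.2)
      simpa [mul_comm] using this
    _ = (∫ u, h u ∂surf) * ∫ r : Set.Ioi (0 : ℝ), p r ∂.volumeIoiPow (Module.finrank ℝ E3 - 1) :=
      integral_prod_mul (fun u : sphere (0 : E3) 1 => h u) (fun r : Set.Ioi (0 : ℝ) => p r)
    _ = _ := by
      rw [mul_comm]
      congr 1
      simp only [Measure.volumeIoiPow, ENNReal.ofReal]
      rw [integral_withDensity_eq_integral_smul,
        integral_subtype_comap measurableSet_Ioi fun a => Real.toNNReal (a ^ (_ : ℕ)) • p a,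
        setIntegral_congr_fun measurableSet_Ioi fun x hx => ?_]
      · simp only [NNReal.smul_def]
        rw [Real.coe_toNNReal _ (pow_nonneg (Set.mem_Ioi.1 hx).le _)]
        simp
      · exact (measurable_subtype_coe.pow_const _).real_toNNReal

/-- A boundary layer estimate: if a continuous function is dominated on the layer by its values on
the inner sphere, then its average against the gradient of the cutoff is controlled by the mean of
those values. -/
theorem integral_cutDeriv_mul_le {A B : ℝ} (hA : 0 < A) (hB : 0 < B) {h : E3 → ℝ}
    (hh : ContinuousOn h (sphere 0 1)) (h0 : ∀ u ∈ sphere (0 : E3) 1, 0 ≤ h u) {G : E3 → ℝ}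
    (hG : ∀ z : E3, A ≤ ‖z‖ → ‖z‖ ≤ A + B → |G z| ≤ h (‖z‖⁻¹ • z)) (i : Fin 3) :
    |∫ z, pd i (cut A B) z * G z| ≤ (A + B) ^ 2 * ∫ u, h u ∂surf := by
  have hmaps : Set.MapsTo (fun z : E3 => ‖z‖⁻¹ • z) {(0 : E3)}ᶜ (sphere 0 1) := by
    intro z hz
    simp [norm_smul, norm_ne_zero_iff.2 hz]
  have hc : ContinuousOn (fun z : E3 => h (‖z‖⁻¹ • z)) {(0 : E3)}ᶜ := by
    refine hh.comp ?_ hmaps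
    exact (continuousOn_id.norm.inv₀ fun z hz => norm_ne_zero_iff.2 hz).smul continuousOn_id
  have hsupp : Function.support (fun z : E3 => cutDeriv A B ‖z‖) ⊆
      closedBall 0 (A + B) ∩ (ball 0 A)ᶜ := by
    intro z hz
    have h1 : ¬ (‖z‖ ≤ A ∨ A + B ≤ ‖z‖) := fun h => hz (cutDeriv_eq_zero hB h)
    push Not at h1
    simpa using ⟨h1.2.le, h1.1.le⟩
  have hclosed : IsClosed (closedBall (0 : E3) (A + B) ∩ (ball 0 A)ᶜ) :=
    isClosed_closedBall.inter isOpen_ball.isClosed_compl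
  have hts := closure_minimal hsupp hclosed
  have hint : Integrable (fun z : E3 => cutDeriv A B ‖z‖ * h (‖z‖⁻¹ • z)) := by
    refine integrable_mul_of_tsupport_subset isOpen_compl_singleton
      ((continuous_cutDeriv A B).comp continuous_norm) ?_ (fun z hz => ?_) hc
    · exact HasCompactSupport.of_support_subset_isCompact
        ((isCompact_closedBall 0 (A + B)).inter_right isOpen_ball.isClosed_compl) hsupp
    · rintro rfl
      exact (hts hz).2 (by simpa using hA)
  have hle := norm_integral_le_of_norm_le (f := fun z => pd i (cut A B) z * G z) hint
    (Eventually.of_forall fun z => ?_)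
  · rw [integral_radial_mul_angular] at hle
    refine hle.trans (mul_le_mul_of_nonneg_right (integral_cutDeriv_le hA hB) ?_)
    exact integral_nonneg fun u => h0 u u.2
  · rw [norm_mul]
    by_cases hz : A ≤ ‖z‖ ∧ ‖z‖ ≤ A + B
    · exact mul_le_mul (abs_pd_cut_le hA hB i z) (hG z hz.1 hz.2) (abs_nonneg _)
        (cutDeriv_nonneg hB _)
    · have h1 : cutDeriv A B ‖z‖ = 0 := by
        by_contra h2
        exact hz (by simpa [and_comm] using hsupp h2)
      have h2 := abs_pd_cut_le hA hB i z
      rw [h1] at h2 ⊢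
      have : ‖pd i (cut A B) z‖ = 0 := le_antisymm h2 (norm_nonneg _)
      rw [this]
      simp

theorem exists_layer {g : E3 → ℝ} (hg : ContinuousOn g {z | 3 ≤ ‖z‖}) {τ : ℝ} (hτ : 0 < τ) :
    ∃ ε : ℝ, 0 < ε ∧ ε ≤ 1 / 2 ∧ ∀ z : E3, 3 ≤ ‖z‖ → ‖z‖ ≤ 3 + ε →
      g z ≤ g ((3 : ℝ) • ‖z‖⁻¹ • z) + τ := by
  have hK : IsCompact (closedBall (0 : E3) 4 ∩ (ball 0 3)ᶜ) :=
    (isCompact_closedBall 0 4).inter_right isOpen_ball.isClosed_compl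
  have hu := hK.uniformContinuousOn_of_continuous
    (hg.mono fun z hz => by simpa using hz.2)
  obtain ⟨η, hη, h⟩ := Metric.uniformContinuousOn_iff.1 hu τ hτ
  refine ⟨min (η / 2) (1 / 2), by positivity, min_le_right _ _, fun z h3 hz => ?_⟩
  have hz0 : 0 < ‖z‖ := by linarith
  have hzε : ‖z‖ ≤ 3 + η / 2 := hz.trans (by gcongr; exact min_le_left _ _)
  have hz4 : ‖z‖ ≤ 3 + 1 / 2 := hz.trans (by gcongr; exact min_le_right _ _)
  have hn : ‖(3 : ℝ) • ‖z‖⁻¹ • z‖ = 3 := by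
    rw [norm_smul, norm_smul, norm_inv, norm_norm, inv_mul_cancel₀ hz0.ne']
    simp
  have hd : dist z ((3 : ℝ) • ‖z‖⁻¹ • z) < η := by
    have : z - (3 : ℝ) • ‖z‖⁻¹ • z = ((‖z‖ - 3) * ‖z‖⁻¹) • z := by
      rw [sub_mul, mul_inv_cancel₀ hz0.ne', sub_smul, one_smul, smul_smul]
    rw [dist_eq_norm, this, norm_smul, norm_mul, norm_inv, norm_norm, mul_assoc,
      inv_mul_cancel₀ hz0.ne', mul_one, Real.norm_of_nonneg (by linarith)]
    linarith
  have := h z ⟨by simp; linarith, by simpa using h3⟩ _ ⟨by simp [hn]; norm_num, by simp [hn]⟩ hd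
  rw [Real.dist_eq] at this
  linarith [(abs_lt.1 this).2]

theorem tsupport_pd_cut_subset {A B : ℝ} (hA : 0 < A) (hB : 0 < B) (i : Fin 3) :
    tsupport (pd i (cut A B)) ⊆ closedBall 0 (A + B) ∩ (ball 0 A)ᶜ := by
  refine closure_minimal (fun z hz => ?_)
    (isClosed_closedBall.inter isOpen_ball.isClosed_compl)
  have h1 : ¬ (‖z‖ ≤ A ∨ A + B ≤ ‖z‖) := fun h => hz <| by
    have := abs_pd_cut_le hA hB i z
    rw [cutDeriv_eq_zero hB h] at this
    exact abs_nonpos_iff.1 this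
  push Not at h1
  simpa using ⟨h1.2.le, h1.1.le⟩

theorem hasCompactSupport_pd_cut {A B : ℝ} (hA : 0 < A) (hB : 0 < B) (i : Fin 3) :
    HasCompactSupport (pd i (cut A B)) :=
  ((isCompact_closedBall 0 (A + B)).inter_right isOpen_ball.isClosed_compl).of_isClosed_subset
    (isClosed_tsupport _) (tsupport_pd_cut_subset hA hB i)

theorem pd_comp_smul (i : Fin 3) (f : E3 → ℝ) (a : ℝ) (z : E3) :
    pd i (fun y => f (a • y)) z = a * pd i f (a • z) := by
  simp [pd, fderiv_comp_smul]

theorem pd_const_mul (i : Fin 3) (f : E3 → ℝ) (a : ℝ) (z : E3) :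
    pd i (fun y => a * f y) z = a * pd i f z := by
  have h : fderiv ℝ (fun y => a * f y) z = a • fderiv ℝ f z :=
    congrFun (fderiv_const_smul_field (f := f) a) z
  simp [pd, h]

theorem pd_cut_scale {R : ℝ} (hR : 0 < R) (i : Fin 3) (z : E3) :
    pd i (cut R R) z = R⁻¹ * pd i (cut 1 1) (R⁻¹ • z) := by
  rw [show cut R R = fun z => cut 1 1 (R⁻¹ • z) from funext (cut_scale hR), pd_comp_smul]

theorem pd_pd_cut_scale {R : ℝ} (hR : 0 < R) (l i : Fin 3) (z : E3) :
    pd l (pd i (cut R R)) z = R⁻¹ * (R⁻¹ * pd l (pd i (cut 1 1)) (R⁻¹ • z)) := by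
  rw [show pd i (cut R R) = fun z => R⁻¹ * pd i (cut 1 1) (R⁻¹ • z) from
    funext (pd_cut_scale hR i), pd_const_mul, pd_comp_smul]

theorem exists_pd_cut_bound : ∃ M : ℝ, 0 ≤ M ∧ ∀ R : ℝ, 0 < R → ∀ (i l : Fin 3) (z : E3),
    |pd i (cut R R) z| ≤ M / R ∧ |pd l (pd i (cut R R)) z| ≤ M / R ^ 2 := by
  have hc : ContDiff ℝ 2 (cut 1 1) := contDiff_cut one_pos one_pos 2
  have h1 : ∀ i : Fin 3, ∃ M, ∀ z, ‖pd i (cut 1 1) z‖ ≤ M := fun i =>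
    (continuous_pd (hc.of_le (by norm_num)) i).bounded_above_of_compact_support
      (hasCompactSupport_pd_cut one_pos one_pos i)
  have h2 : ∀ l i : Fin 3, ∃ M, ∀ z, ‖pd l (pd i (cut 1 1)) z‖ ≤ M := fun l i =>
    (continuous_pd (contDiff_pd hc i) l).bounded_above_of_compact_support
      (hasCompactSupport_pd (hasCompactSupport_pd_cut one_pos one_pos i) l)
  choose M1 hM1 using h1
  choose M2 hM2 using h2
  have hM1' : ∀ i, 0 ≤ M1 i := fun i => (norm_nonneg _).trans (hM1 i 0)
  have hM2' : ∀ l i, 0 ≤ M2 l i := fun l i => (norm_nonneg _).trans (hM2 l i 0)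
  refine ⟨∑ i, M1 i + ∑ l, ∑ i, M2 l i, ?_, fun R hR i l z => ⟨?_, ?_⟩⟩
  · exact add_nonneg (Finset.sum_nonneg fun i _ => hM1' i)
      (Finset.sum_nonneg fun l _ => Finset.sum_nonneg fun i _ => hM2' l i)
  · rw [pd_cut_scale hR, abs_mul, abs_of_pos (inv_pos.2 hR), div_eq_inv_mul]
    refine mul_le_mul_of_nonneg_left ((hM1 i _).trans ?_) (by positivity)
    refine le_add_of_le_of_nonneg (Finset.single_le_sum (fun i _ => hM1' i) (Finset.mem_univ i)) ?_
    exact Finset.sum_nonneg fun l _ => Finset.sum_nonneg fun i _ => hM2' l i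
  · rw [pd_pd_cut_scale hR, abs_mul, abs_mul, abs_of_pos (inv_pos.2 hR), ← mul_assoc, ← mul_inv,
      ← sq, div_eq_inv_mul]
    refine mul_le_mul_of_nonneg_left ((hM2 l i _).trans ?_) (by positivity)
    refine le_add_of_nonneg_of_le (Finset.sum_nonneg fun i _ => hM1' i) ?_
    exact (Finset.single_le_sum (fun i _ => hM2' l i) (Finset.mem_univ i)).trans
      (Finset.single_le_sum (f := fun l => ∑ i, M2 l i)
        (fun l _ => Finset.sum_nonneg fun i _ => hM2' l i) (Finset.mem_univ l))

/-- The contribution of the far shell is negligible, uniformly in the regularization. -/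
theorem exists_far_bound {w : E3 → ℝ} {s : Set E3} (hs : IsOpen s) (h3 : {z : E3 | 3 ≤ ‖z‖} ⊆ s)
    (hw : ContDiffOn ℝ 2 w s) {c R₀ : ℝ} (hd : ∀ z : E3, R₀ ≤ ‖z‖ → |w z| ≤ c / ‖z‖ ^ 2) {x : E3}
    (hx : 4 ≤ ‖x‖) :
    ∃ K R₁ : ℝ, ∀ R, R₁ ≤ R → ∀ δ, 0 < δ → ∀ i j l : Fin 3,
      |∫ z, pd i (cut R R) z * ((regKernel x δ j z - regKernel x δ j 0) * pd l w z)| ≤ K / R := by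
  obtain ⟨M, hM, hcut⟩ := exists_pd_cut_bound
  refine ⟨34 * M * |c| * (8 * volume.real (ball (0 : E3) 1)), max R₀ (2 * ‖x‖), ?_⟩
  intro R hR δ hδ i j l
  have hR0 : R₀ ≤ R := (le_max_left _ _).trans hR
  have hRx : 2 * ‖x‖ ≤ R := (le_max_right _ _).trans hR
  have hRp : 0 < R := by linarith
  set ψ : E3 → ℝ := fun z => regKernel x δ j z - regKernel x δ j 0 with hψdef
  have hψ : ContDiff ℝ 1 ψ := (contDiff_regKernel hδ x j 1).sub contDiff_const
  have hcu : ContDiff ℝ 1 (pd i (cut R R)) := contDiff_pd (contDiff_cut hRp hRp 2) i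
  have hts : tsupport (fun z => pd i (cut R R) z * ψ z) ⊆
      closedBall 0 (R + R) ∩ (ball 0 R)ᶜ :=
    tsupport_mul_subset_left.trans (tsupport_pd_cut_subset hRp hRp i)
  have hcs : HasCompactSupport (fun z => pd i (cut R R) z * ψ z) :=
    (hasCompactSupport_pd_cut hRp hRp i).mul_right
  have key := integral_mul_pd hs (hcu.mul hψ) hcs
    (hts.trans fun z hz => h3 (by have := hz.2; simp at this ⊢; linarith))
    (hw.of_le (by norm_num)) l
  have e1 : ∫ z, pd i (cut R R) z * (ψ z * pd l w z) =
      -∫ z, pd l (fun z => pd i (cut R R) z * ψ z) z * w z := by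
    rw [← key]
    simp only [mul_assoc]
  rw [e1, abs_neg]
  have hzero : ∀ z, z ∉ closedBall (0 : E3) (R + R) ∩ (ball 0 R)ᶜ →
      pd l (fun z => pd i (cut R R) z * ψ z) z * w z = 0 := by
    intro z hz
    have : pd l (fun z => pd i (cut R R) z * ψ z) z = 0 := by
      by_contra h
      exact hz (hts (tsupport_pd_subset _ l (subset_tsupport _ h)))
    rw [this, zero_mul]
  rw [← setIntegral_eq_integral_of_forall_compl_eq_zero (s := closedBall (0 : E3) (R + R))
    fun z hz => hzero z fun h => hz h.1]
  have hxp : 0 < ‖x‖ := by linarith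
  have hpt : ∀ z ∈ closedBall (0 : E3) (R + R),
      ‖pd l (fun z => pd i (cut R R) z * ψ z) z * w z‖ ≤ 34 * M / R ^ 2 * (|c| / R ^ 2) := by
    intro z hz
    by_cases hzR : R ≤ ‖z‖
    swap
    · rw [hzero z fun h => hzR (by simpa using h.2), norm_zero]
      positivity
    have hzx : R / 2 ≤ ‖z - x‖ := by
      have := norm_sub_norm_le z x
      linarith
    have hr1 : regInv x δ z ≤ (R / 2)⁻¹ := regInv_le_inv x δ (by positivity) hzx
    have hr0 : regInv x δ 0 ≤ ‖x‖⁻¹ := regInv_le_inv x δ hxp (by simp)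
    have hr1' : regInv x δ z ≤ 1 := hr1.trans (inv_le_one_of_one_le₀ (by linarith))
    have hr0' : regInv x δ 0 ≤ 1 := hr0.trans (inv_le_one_of_one_le₀ (by linarith))
    have hp1 := (regInv_pos hδ x z).le
    have hp0 := (regInv_pos hδ x 0).le
    have hb1 : |ψ z| ≤ 2 := by
      have a1 := abs_regKernel_le hδ x z j
      have a2 := abs_regKernel_le hδ x 0 j
      have a3 : regInv x δ z ^ 2 ≤ 1 := pow_le_one₀ hp1 hr1'
      have a4 : regInv x δ 0 ^ 2 ≤ 1 := pow_le_one₀ hp0 hr0'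
      exact (abs_sub _ _).trans (by linarith)
    have hb2 : |pd l ψ z| ≤ 32 / R := by
      refine (abs_pd_le l ψ z).trans ?_
      rw [hψdef, fderiv_sub_const]
      refine (norm_fderiv_regKernel_le hδ x z j).trans ?_
      calc 4 * regInv x δ z ^ 3 ≤ 4 * (R / 2)⁻¹ ^ 3 := by gcongr
        _ = 32 / R * (1 / R ^ 2) := by field_simp; norm_num
        _ ≤ 32 / R * 1 := by
          gcongr
          rw [div_le_one (by positivity)]
          nlinarith
        _ = 32 / R := mul_one _
    obtain ⟨hc1, hc2⟩ := hcut R hRp i l z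
    have hb3 : |w z| ≤ |c| / R ^ 2 := by
      refine (hd z (hR0.trans hzR)).trans ?_
      calc c / ‖z‖ ^ 2 ≤ |c| / ‖z‖ ^ 2 := by gcongr; exact le_abs_self c
        _ ≤ |c| / R ^ 2 := by gcongr
    rw [norm_mul, pd_mul (hcu.differentiable one_ne_zero z) (hψ.differentiable one_ne_zero z)]
    refine mul_le_mul ?_ hb3 (norm_nonneg _) (by positivity)
    calc ‖pd l (pd i (cut R R)) z * ψ z + pd i (cut R R) z * pd l ψ z‖
        ≤ |pd l (pd i (cut R R)) z| * |ψ z| + |pd i (cut R R) z| * |pd l ψ z| := by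
          rw [← abs_mul, ← abs_mul]; exact norm_add_le _ _
      _ ≤ M / R ^ 2 * 2 + M / R * (32 / R) := by gcongr
      _ = 34 * M / R ^ 2 := by field_simp; ring
  refine (norm_setIntegral_le_of_norm_le_const measure_closedBall_lt_top hpt).trans ?_
  have hvol : volume.real (closedBall (0 : E3) (R + R)) =
      (R + R) ^ 3 * volume.real (ball (0 : E3) 1) := by
    rw [Measure.addHaar_real_closedBall _ _ (by positivity)]
    simp
  rw [hvol]
  refine le_of_eq ?_
  field_simp
  ring

/-- The total mass of the unit-scale peak `3 (1 + ‖y‖²)^(-5/2)`. -/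
def peakMass : ℝ := ∫ y : E3, 3 * regInv 0 1 y ^ 5

theorem integrable_peak : Integrable (fun y : E3 => 3 * regInv 0 1 y ^ 5) := by
  have h := (integrable_rpow_neg_one_add_norm_sq (E := E3) (μ := volume) (r := 5)
    (by simp; norm_num)).const_mul 3
  refine h.congr (Eventually.of_forall fun y => ?_)
  have hp : (0 : ℝ) < 1 + ‖y‖ ^ 2 := by positivity
  simp only [regInv, sub_zero, one_pow]
  rw [add_comm (‖y‖ ^ 2), Real.sqrt_eq_rpow, ← Real.rpow_neg hp.le,
    ← Real.rpow_mul_natCast hp.le]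
  norm_num

theorem peakMass_pos : 0 < peakMass := by
  have hp : ∀ y : E3, 0 < 3 * regInv 0 1 y ^ 5 := fun y => by
    have := regInv_pos one_pos 0 y
    positivity
  refine (integral_pos_iff_support_of_nonneg (fun y => (hp y).le) integrable_peak).2 ?_
  rw [Function.support_eq_univ fun y => (hp y).ne']
  simp

theorem tendsto_integral_peak {g : E3 → ℝ} {x : E3} (hg : Integrable g) (hgx : ContinuousAt g x) :
    Tendsto (fun c : ℝ => ∫ z, g z * (3 * c⁻¹ ^ 2 * regInv x c⁻¹ z ^ 5)) atTop
      (nhds (peakMass * g x)) := by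
  have hk := peakMass_pos
  have h := tendsto_integral_comp_smul_smul_of_integrable' (μ := (volume : Measure E3))
    (φ := fun y : E3 => peakMass⁻¹ * (3 * regInv 0 1 y ^ 5)) (g := g) (x₀ := x)
    (fun y => by
      have := regInv_pos one_pos 0 y
      positivity)
    (by rw [integral_const_mul, ← peakMass, inv_mul_cancel₀ hk.ne']) ?_ hg hgx
  · refine (h.const_mul peakMass).congr' ?_
    filter_upwards [eventually_gt_atTop 0] with c hc
    rw [← integral_const_mul]
    refine integral_congr_ae (Eventually.of_forall fun z => ?_)
    have hr : regInv 0 1 (c • (x - z)) = c⁻¹ * regInv x c⁻¹ z := by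
      simp only [regInv, sub_zero, norm_smul, Real.norm_of_nonneg hc.le, one_pow]
      rw [← mul_inv, norm_sub_rev x z]
      congr 1
      rw [← Real.sqrt_sq hc.le, ← Real.sqrt_mul (by positivity)]
      congr 1
      rw [Real.sqrt_sq hc.le]
      field_simp
    simp only [hr, smul_eq_mul, finrank_euclideanSpace, Fintype.card_fin]
    field_simp
  · have h1 : Tendsto (fun y : E3 => 3 * peakMass⁻¹ * (‖y‖⁻¹) ^ 2) (Bornology.cobounded E3)
        (nhds 0) := by
      have := ((tendsto_inv_atTop_zero.comp
        (tendsto_norm_cobounded_atTop (E := E3))).pow 2).const_mul (3 * peakMass⁻¹)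
      simpa using this
    refine squeeze_zero' (Eventually.of_forall fun y => ?_) ?_ h1
    · have := regInv_pos one_pos 0 y
      positivity
    · filter_upwards [(tendsto_norm_cobounded_atTop (E := E3)).eventually_gt_atTop 0] with y hy
      have h2 := norm_mul_regInv_le 0 1 y
      have h3 : regInv 0 1 y ≤ ‖y‖⁻¹ := regInv_le_inv 0 1 hy (by simp)
      have h0 := (regInv_pos one_pos 0 y).le
      rw [sub_zero] at h2
      simp only [finrank_euclideanSpace, Fintype.card_fin]
      calc ‖y‖ ^ 3 * (peakMass⁻¹ * (3 * regInv 0 1 y ^ 5))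
          = 3 * peakMass⁻¹ * ((‖y‖ * regInv 0 1 y) ^ 3 * regInv 0 1 y ^ 2) := by ring
        _ ≤ 3 * peakMass⁻¹ * (1 ^ 3 * ‖y‖⁻¹ ^ 2) := by gcongr
        _ = 3 * peakMass⁻¹ * ‖y‖⁻¹ ^ 2 := by ring

/-- The gradient of a harmonic exterior field is controlled by its mean over the sphere of
radius `3`. -/
theorem peakMass_mul_abs_pd_le {w : E3 → ℝ} {s : Set E3} (hs : IsOpen s)
    (h3 : {z : E3 | 3 ≤ ‖z‖} ⊆ s) (hw : ContDiffOn ℝ 2 w s)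
    (hΔ : ∀ z ∈ s, ∑ i, pd i (pd i w) z = 0) {c R₀ : ℝ}
    (hd : ∀ z : E3, R₀ ≤ ‖z‖ → |w z| ≤ c / ‖z‖ ^ 2) {x : E3} (hx : 4 ≤ ‖x‖) (k : Fin 3) :
    peakMass * |pd k w x| ≤
      9 * ((7 / 2) ^ 2 * (7168 / ‖x‖ ^ 3 * ∫ u, ‖fderiv ℝ w ((3 : ℝ) • u.1)‖ ∂surf)) := by
  set g : E3 → ℝ := fun z => ‖fderiv ℝ w z‖ with hgdef
  have hg : ContinuousOn g {z | 3 ≤ ‖z‖} :=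
    ((hw.continuousOn_fderiv_of_isOpen hs (by norm_num)).mono h3).norm
  have hgs : ContinuousOn (fun u : E3 => g ((3 : ℝ) • u)) (sphere 0 1) :=
    hg.comp (by fun_prop) fun u hu => by
      have : ‖u‖ = 1 := by simpa using hu
      simp [norm_smul, this]
  have hgi : Integrable (fun u : sphere (0 : E3) 1 => g ((3 : ℝ) • u.1)) surf := by
    have hcont : Continuous (fun u : sphere (0 : E3) 1 => g ((3 : ℝ) • u.1)) :=
      continuousOn_iff_continuous_domRestrict.1 hgs
    exact hcont.integrable_of_hasCompactSupport (HasCompactSupport.of_compactSpace _)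
  obtain ⟨K, R₁, hfar⟩ := exists_far_bound hs h3 hw hd hx
  have hFcd : ∀ i, ContDiffOn ℝ 1 (pd i w) s := contDiffOn_pd hs hw
  set Q : ℝ := 7168 / ‖x‖ ^ 3 with hQ
  have hQ0 : 0 ≤ Q := by positivity
  set V : ℝ := surf.real Set.univ with hV
  have step : ∀ τ : ℝ, 0 < τ → peakMass * |pd k w x| ≤
      9 * ((7 / 2) ^ 2 * (Q * (∫ u, g ((3 : ℝ) • u.1) ∂surf + τ * V))) := by
    intro τ hτ
    obtain ⟨ε, hε, hε2, hlayer⟩ := exists_layer hg hτ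
    set h : E3 → ℝ := fun u => Q * (g ((3 : ℝ) • u) + τ) with hh
    have hnear : ∀ δ, 0 < δ → ∀ i j l : Fin 3,
        |∫ z, pd i (cut 3 ε) z * ((regKernel x δ j z - regKernel x δ j 0) * pd l w z)| ≤
          (7 / 2) ^ 2 * ∫ u, h u ∂surf := by
      intro δ hδ i j l
      refine (integral_cutDeriv_mul_le (by norm_num) hε (h := h)
        (continuousOn_const.mul (hgs.add continuousOn_const)) ?_ ?_ i).trans ?_
      · intro u _
        have : 0 ≤ g ((3 : ℝ) • u) := norm_nonneg _
        positivity
      · intro z hz1 hz2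
        rw [abs_mul]
        refine mul_le_mul (abs_regKernel_sub_le hδ hx (by linarith) j) ?_ (abs_nonneg _) hQ0
        exact (abs_pd_le l w z).trans (hlayer z hz1 hz2)
      · refine mul_le_mul_of_nonneg_right (pow_le_pow_left₀ (by linarith) (by linarith) 2) ?_
        refine integral_nonneg fun u => ?_
        have : 0 ≤ g ((3 : ℝ) • u.1) := norm_nonneg _
        positivity
    have hint : ∫ u : sphere (0 : E3) 1, h u ∂surf =
        Q * (∫ u, g ((3 : ℝ) • u.1) ∂surf + τ * V) := by
      rw [hh]
      simp only
      rw [integral_const_mul, integral_add hgi (integrable_const _), integral_const, smul_eq_mul,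
        mul_comm τ]
    rw [← hint]
    have hR : ∀ R, max R₁ ‖x‖ ≤ R →
        peakMass * |pd k w x| ≤ 9 * ((7 / 2) ^ 2 * ∫ u, h u ∂surf + K / R) := by
      intro R hR
      have hR1 : R₁ ≤ R := (le_max_left _ _).trans hR
      have hRx : ‖x‖ ≤ R := (le_max_right _ _).trans hR
      have hRp : 0 < R := by linarith
      set ζ : E3 → ℝ := fun z => cut 3 ε z - cut R R z with hζdef
      have hζ1 : ContDiff ℝ 1 (cut 3 ε) := contDiff_cut (by norm_num) hε 1
      have hζ2 : ContDiff ℝ 1 (cut R R) := contDiff_cut hRp hRp 1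
      have hζ : ContDiff ℝ 1 ζ := hζ1.sub hζ2
      have hsupp : Function.support ζ ⊆ closedBall 0 (R + R) ∩ (ball 0 3)ᶜ := by
        intro z hz
        by_contra hcon
        refine hz ?_
        simp only [Set.mem_inter_iff, mem_closedBall_zero_iff, Set.mem_compl_iff,
          mem_ball_zero_iff, not_and_or, not_le, not_not] at hcon
        rcases hcon with hcon | hcon
        · simp [hζdef, cut_eq_one hε (show 3 + ε ≤ ‖z‖ by linarith), cut_eq_one hRp hcon.le]
        · simp [hζdef, cut_eq_zero hε hcon.le, cut_eq_zero hRp (show ‖z‖ ≤ R by linarith)]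
      have hcomp : IsCompact (closedBall (0 : E3) (R + R) ∩ (ball 0 3)ᶜ) :=
        (isCompact_closedBall 0 _).inter_right isOpen_ball.isClosed_compl
      have hc : HasCompactSupport ζ := HasCompactSupport.of_support_subset_isCompact hcomp hsupp
      have hsub : tsupport ζ ⊆ s := (closure_minimal hsupp hcomp.isClosed).trans fun z hz =>
        h3 (by simpa using hz.2)
      have hpdζ : ∀ i z, pd i ζ z = pd i (cut 3 ε) z - pd i (cut R R) z := by
        intro i z
        simp only [pd, hζdef]
        rw [fderiv_fun_sub (hζ1.differentiable one_ne_zero z)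
          (hζ2.differentiable one_ne_zero z)]
        rfl
      have hxs : x ∈ s := h3 (show (3 : ℝ) ≤ ‖x‖ by linarith)
      have hζx : ζ x = 1 := by
        simp [hζdef, cut_eq_one hε (show 3 + ε ≤ ‖x‖ by linarith), cut_eq_zero hRp hRx]
      have hδ : ∀ δ, 0 < δ → |∫ z, (ζ z * pd k w z) * (3 * δ ^ 2 * regInv x δ z ^ 5)| ≤
          9 * ((7 / 2) ^ 2 * ∫ u, h u ∂surf + K / R) := by
        intro δ hδ
        set ψ : Fin 3 → E3 → ℝ := fun j z => regKernel x δ j z - regKernel x δ j 0 with hψdef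
        have hψ : ∀ j, ContDiff ℝ 1 (ψ j) := fun j =>
          (contDiff_regKernel hδ x j 1).sub contDiff_const
        have hpdψ : ∀ i j z, pd i (ψ j) z = pd i (regKernel x δ j) z := by
          intro i j z
          simp only [pd, hψdef]
          rw [fderiv_sub_const]
        have hI : ∀ A B : ℝ, 0 < A → 0 < B → 3 ≤ A → ∀ i j l : Fin 3,
            Integrable (fun z => pd i (cut A B) z * (ψ j z * pd l w z)) := by
          intro A B hA hB hA3 i j l
          refine integrable_mul_of_tsupport_subset hs
            (continuous_pd (contDiff_cut hA hB 1) i) (hasCompactSupport_pd_cut hA hB i)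
            ((tsupport_pd_cut_subset hA hB i).trans fun z hz => h3 ?_)
            ((hψ j).continuous.continuousOn.mul (hFcd l).continuousOn)
          have : A ≤ ‖z‖ := by simpa using hz.2
          exact hA3.trans this
        have hB : ∀ i j l, |∫ z, pd i ζ z * (ψ j z * pd l w z)| ≤
            (7 / 2) ^ 2 * ∫ u, h u ∂surf + K / R := by
          intro i j l
          simp only [hpdζ, sub_mul]
          rw [integral_sub (hI 3 ε (by norm_num) hε le_rfl i j l)
            (hI R R hRp hRp (by linarith) i j l)]
          exact (abs_sub _ _).trans (add_le_add (hnear δ hδ i j l) (hfar R hR1 δ hδ i j l))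
        have := abs_integral_mul_div_le hs hζ hc hsub hFcd hψ
          (fun i j z hz => pd_pd_comm hs hw i j hz) hΔ
          (fun i j z => by rw [hpdψ, hpdψ, pd_regKernel_comm hδ]) hB k
        simp only [hpdψ, sum_pd_regKernel hδ] at this
        simpa only [mul_assoc] using this
      have hgint : Integrable (fun z => ζ z * pd k w z) :=
        integrable_mul_of_tsupport_subset hs hζ.continuous hc hsub (hFcd k).continuousOn
      have hgx : ContinuousAt (fun z => ζ z * pd k w z) x :=
        hζ.continuous.continuousAt.mul ((hFcd k).continuousOn.continuousAt (hs.mem_nhds hxs))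
      have hlim := (tendsto_integral_peak hgint hgx).abs
      rw [hζx, one_mul, abs_mul, abs_of_pos peakMass_pos] at hlim
      refine le_of_tendsto hlim ?_
      filter_upwards [eventually_gt_atTop 0] with t ht
      exact hδ t⁻¹ (inv_pos.2 ht)
    have hlim : Tendsto (fun R : ℝ => 9 * ((7 / 2) ^ 2 * ∫ u, h u ∂surf + K / R)) atTop
        (nhds (9 * ((7 / 2) ^ 2 * ∫ u, h u ∂surf + 0))) :=
      (tendsto_const_nhds.add (tendsto_const_nhds.div_atTop tendsto_id)).const_mul 9
    rw [add_zero] at hlim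
    refine ge_of_tendsto hlim ?_
    filter_upwards [eventually_ge_atTop (max R₁ ‖x‖)] with R h using hR R h
  have hlim : Tendsto (fun τ : ℝ =>
      9 * ((7 / 2) ^ 2 * (Q * (∫ u, g ((3 : ℝ) • u.1) ∂surf + τ * V)))) (nhdsWithin 0 (Set.Ioi 0))
      (nhds (9 * ((7 / 2) ^ 2 * (Q * (∫ u, g ((3 : ℝ) • u.1) ∂surf + 0 * V))))) := by
    refine tendsto_nhdsWithin_of_tendsto_nhds (Continuous.tendsto (by fun_prop) 0)
  rw [zero_mul, add_zero] at hlim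
  refine ge_of_tendsto hlim ?_
  filter_upwards [self_mem_nhdsWithin] with τ hτ using step τ hτ

open scoped Pointwise in
theorem surf_closedBall_le {ω : E3} (hω : ‖ω‖ ≤ 1) {d : ℝ} (hd : 0 < d) (hd1 : d ≤ 1) :
    surf {u | ‖u.1 - ω‖ ≤ d} ≤ ENNReal.ofReal (48 * d ^ 2) * volume (ball (0 : E3) 1) := by
  have hm : MeasurableSet {u : sphere (0 : E3) 1 | ‖u.1 - ω‖ ≤ d} :=
    (isClosed_le (by fun_prop) continuous_const).measurableSet
  rw [Measure.toSphere_apply' _ hm]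
  set N : ℕ := ⌈1 / d⌉₊ with hN
  have hN1 : 1 / d ≤ N := Nat.le_ceil _
  have hN2 : (N : ℝ) ≤ 2 / d := by
    have h1 : (N : ℝ) < 1 / d + 1 := Nat.ceil_lt_add_one (by positivity)
    have h2 : 1 ≤ 1 / d := (one_le_div hd).2 hd1
    have h3 : 2 / d = 1 / d + 1 / d := by ring
    linarith
  have hNp : (0 : ℝ) < N := lt_of_lt_of_le (by positivity) hN1
  have hsub : Set.Ioo (0 : ℝ) 1 • (Subtype.val '' {u : sphere (0 : E3) 1 | ‖u.1 - ω‖ ≤ d}) ⊆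
      ⋃ k ∈ Finset.range N, closedBall (((k : ℝ) / N) • ω) (2 * d) := by
    rintro _ ⟨t, ht, _, ⟨u, hu, rfl⟩, rfl⟩
    have ht0 := ht.1
    have htN : 0 ≤ t * N := by positivity
    simp only [Set.mem_iUnion, Finset.mem_range, mem_closedBall, dist_eq_norm]
    refine ⟨⌊t * N⌋₊, (Nat.floor_lt htN).2 (by nlinarith [ht.2]), ?_⟩
    have hf1 := Nat.floor_le htN
    have hf2 := Nat.lt_floor_add_one (t * N)
    have hk : |t - (⌊t * N⌋₊ : ℝ) / N| ≤ d := by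
      have : t - (⌊t * N⌋₊ : ℝ) / N = (t * N - ⌊t * N⌋₊) / N := by field_simp
      rw [this, abs_of_nonneg (by apply div_nonneg <;> linarith)]
      rw [div_le_iff₀ hNp]
      rw [div_le_iff₀ hd] at hN1
      nlinarith
    have hs : t • u.1 - ((⌊t * N⌋₊ : ℝ) / N) • ω =
        t • (u.1 - ω) + (t - (⌊t * N⌋₊ : ℝ) / N) • ω := by
      rw [smul_sub, sub_smul]
      abel
    calc ‖t • u.1 - ((⌊t * N⌋₊ : ℝ) / N) • ω‖
        ≤ ‖t • (u.1 - ω)‖ + ‖(t - (⌊t * N⌋₊ : ℝ) / N) • ω‖ := by rw [hs]; exact norm_add_le _ _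
      _ = t * ‖u.1 - ω‖ + |t - (⌊t * N⌋₊ : ℝ) / N| * ‖ω‖ := by
          rw [norm_smul, norm_smul, Real.norm_of_nonneg ht0.le, Real.norm_eq_abs]
      _ ≤ 1 * d + d * 1 := by
          have : ‖u.1 - ω‖ ≤ d := hu
          gcongr
          exact ht.2.le
      _ = 2 * d := by ring
  have hball : ∀ y : E3, volume (closedBall y (2 * d)) =
      ENNReal.ofReal ((2 * d) ^ 3) * volume (ball (0 : E3) 1) := by
    intro y
    rw [Measure.addHaar_closedBall _ _ (by positivity)]
    simp
  calc (Module.finrank ℝ E3 : ENNReal) * volume (Set.Ioo (0 : ℝ) 1 •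
        (Subtype.val '' {u : sphere (0 : E3) 1 | ‖u.1 - ω‖ ≤ d}))
      ≤ 3 * ∑ k ∈ Finset.range N, volume (closedBall (((k : ℝ) / N) • ω) (2 * d)) := by
        rw [finrank_euclideanSpace, Fintype.card_fin]
        exact mul_le_mul_right ((measure_mono hsub).trans (measure_biUnion_finset_le _ _)) _
    _ = ENNReal.ofReal (3 * N * (2 * d) ^ 3) * volume (ball (0 : E3) 1) := by
        simp only [hball, Finset.sum_const, Finset.card_range, nsmul_eq_mul]
        rw [ENNReal.ofReal_mul (by positivity), ENNReal.ofReal_mul (by norm_num)]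
        simp [mul_assoc]
    _ ≤ ENNReal.ofReal (48 * d ^ 2) * volume (ball (0 : E3) 1) := by
        refine mul_le_mul_left (ENNReal.ofReal_le_ofReal ?_) _
        calc 3 * N * (2 * d) ^ 3 ≤ 3 * (2 / d) * (2 * d) ^ 3 := by gcongr
          _ = 48 * d ^ 2 := by field_simp; norm_num

/-- The push-forward of the surface measure of the unit sphere to the sphere of radius `3`. -/
def surf₃ : Measure E3 := surf.map fun u => (3 : ℝ) • u.1

theorem surf₃_le_ediam_sq {t : Set E3} (ht : ediam t ≤ 1) :
    surf₃ t ≤ 48 * volume (ball (0 : E3) 1) * ediam t ^ (2 : ℝ) := by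
  have hm : Measurable fun u : sphere (0 : E3) 1 => (3 : ℝ) • u.1 := by fun_prop
  set d : ℝ := (ediam t).toReal with hd
  have hfin : ediam t ≠ ⊤ := ne_top_of_le_ne_top ENNReal.one_ne_top ht
  have hd1 : d ≤ 1 := by
    rw [hd]
    exact ENNReal.toReal_le_of_le_ofReal zero_le_one (by simpa using ht)
  have hbound : ∀ η : ℝ, 0 < η → η ≤ 1 →
      surf₃ t ≤ ENNReal.ofReal (48 * (d + η) ^ 2) * volume (ball (0 : E3) 1) := by
    intro η hη hη1
    by_cases hne : ∃ u : sphere (0 : E3) 1, (3 : ℝ) • u.1 ∈ t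
    · obtain ⟨u₀, hu₀⟩ := hne
      have hsub : t ⊆ closedBall ((3 : ℝ) • u₀.1) (d + η) := by
        intro z hz
        have h1 : dist z ((3 : ℝ) • u₀.1) ≤ d := by
          rw [dist_edist]
          exact ENNReal.toReal_mono hfin (edist_le_ediam_of_mem hz hu₀)
        exact mem_closedBall.2 (by linarith)
      have hu1 : ‖u₀.1‖ ≤ 1 := (mem_sphere_zero_iff_norm.1 u₀.2).le
      have hd0 : 0 ≤ d := ENNReal.toReal_nonneg
      calc surf₃ t ≤ surf₃ (closedBall ((3 : ℝ) • u₀.1) (d + η)) := measure_mono hsub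
        _ = surf ((fun u : sphere (0 : E3) 1 => (3 : ℝ) • u.1) ⁻¹'
              closedBall ((3 : ℝ) • u₀.1) (d + η)) :=
            Measure.map_apply hm measurableSet_closedBall
        _ ≤ surf {u | ‖u.1 - u₀.1‖ ≤ (d + η) / 3} := by
            refine measure_mono fun u hu => ?_
            have h1 : ‖(3 : ℝ) • u.1 - (3 : ℝ) • u₀.1‖ ≤ d + η := by
              simpa [dist_eq_norm] using hu
            rw [← smul_sub, norm_smul, Real.norm_of_nonneg (by norm_num)] at h1
            show ‖u.1 - u₀.1‖ ≤ (d + η) / 3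
            linarith
        _ ≤ ENNReal.ofReal (48 * ((d + η) / 3) ^ 2) * volume (ball (0 : E3) 1) :=
            surf_closedBall_le hu1 (by positivity) (by linarith)
        _ ≤ ENNReal.ofReal (48 * (d + η) ^ 2) * volume (ball (0 : E3) 1) := by
            refine mul_le_mul_left (ENNReal.ofReal_le_ofReal ?_) _
            nlinarith [sq_nonneg (d + η)]
    · have hsub : t ⊆ (sphere (0 : E3) 3)ᶜ := by
        intro z hz hz3
        have hz3' : ‖z‖ = 3 := by simpa using hz3
        refine hne ⟨⟨(3 : ℝ)⁻¹ • z, by simp [norm_smul, hz3']⟩, ?_⟩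
        simpa [smul_smul] using hz
      refine (measure_mono hsub).trans ?_
      rw [surf₃, Measure.map_apply hm isClosed_sphere.measurableSet.compl]
      have : (fun u : sphere (0 : E3) 1 => (3 : ℝ) • u.1) ⁻¹' (sphere (0 : E3) 3)ᶜ = ∅ := by
        ext u
        have hu : ‖u.1‖ = 1 := mem_sphere_zero_iff_norm.1 u.2
        simp [norm_smul]
      rw [this]
      simp
  have hlim : Tendsto (fun η : ℝ => ENNReal.ofReal (48 * (d + η) ^ 2) * volume (ball (0 : E3) 1))
      (nhdsWithin 0 (Set.Ioi 0))
      (nhds (ENNReal.ofReal (48 * (d + 0) ^ 2) * volume (ball (0 : E3) 1))) := by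
    refine tendsto_nhdsWithin_of_tendsto_nhds ?_
    refine ENNReal.Tendsto.mul_const ?_ (Or.inr measure_ball_lt_top.ne)
    exact (ENNReal.continuous_ofReal.comp (by fun_prop)).tendsto 0
  have hle : surf₃ t ≤ ENNReal.ofReal (48 * (d + 0) ^ 2) * volume (ball (0 : E3) 1) := by
    refine ge_of_tendsto hlim ?_
    filter_upwards [Ioc_mem_nhdsGT zero_lt_one] with η hη using hbound η hη.1 hη.2
  refine hle.trans (le_of_eq ?_)
  rw [add_zero, ENNReal.ofReal_mul (by norm_num), ENNReal.ofReal_pow ENNReal.toReal_nonneg,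
    ENNReal.ofReal_toReal hfin, ENNReal.rpow_two]
  simp
  ring

theorem surf₃_le_hausdorff : surf₃ ≤ (48 * volume (ball (0 : E3) 1)) • (μH[2] : Measure E3) := by
  set K : ENNReal := 48 * volume (ball (0 : E3) 1) with hK
  have hK0 : K ≠ 0 := mul_ne_zero (by norm_num) (measure_ball_pos _ _ one_pos).ne'
  have hKt : K ≠ ⊤ := ENNReal.mul_ne_top (by norm_num) measure_ball_lt_top.ne
  have h : K⁻¹ • surf₃ ≤ (μH[2] : Measure E3) := by
    refine Measure.le_hausdorffMeasure 2 _ 1 one_pos fun t ht => ?_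
    rw [Measure.smul_apply, smul_eq_mul, ← ENNReal.div_eq_inv_mul]
    exact ENNReal.div_le_of_le_mul' (surf₃_le_ediam_sq ht)
  intro t
  have := h t
  rw [Measure.smul_apply, smul_eq_mul] at this ⊢
  rwa [ENNReal.inv_mul_le_iff hK0 hKt] at this

/-- Spherical coordinates on the sphere of radius `3`. -/
def sphereParam (p : ℝ × ℝ) : E3 :=
  !₂[3 * (cos p.1 * cos p.2), 3 * (cos p.1 * sin p.2), 3 * sin p.1]

theorem contDiff_sphereParam : ContDiff ℝ 1 sphereParam := by
  refine contDiff_euclidean.2 fun i => ?_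
  fin_cases i <;> simp [sphereParam] <;> fun_prop

theorem sphere_subset_image_sphereParam :
    sphere (0 : E3) 3 ⊆ sphereParam '' (Set.Icc (-π) π ×ˢ Set.Icc (-π) π) := by
  intro z hz
  have hz3 : ‖z‖ = 3 := by simpa using hz
  have hsq : z 0 ^ 2 + z 1 ^ 2 + z 2 ^ 2 = 9 := by
    have := EuclideanSpace.real_norm_sq_eq z
    rw [hz3, Fin.sum_univ_three] at this
    linarith
  set r : ℂ := ⟨z 0, z 1⟩ with hr
  set q : ℂ := ⟨‖r‖, z 2⟩ with hq
  have hr2 : ‖r‖ ^ 2 = z 0 ^ 2 + z 1 ^ 2 := by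
    rw [Complex.sq_norm, Complex.normSq_apply]
    ring
  have hqn : ‖q‖ = 3 := by
    have h1 : ‖q‖ ^ 2 = 3 ^ 2 := by
      rw [Complex.sq_norm, Complex.normSq_apply]
      nlinarith
    exact (pow_left_inj₀ (norm_nonneg _) (by norm_num) two_ne_zero).1 h1
  have hq1 : 3 * cos q.arg = ‖r‖ := by rw [← hqn, Complex.norm_mul_cos_arg]
  have hq2 : 3 * sin q.arg = z 2 := by rw [← hqn, Complex.norm_mul_sin_arg]
  refine ⟨(q.arg, r.arg), ⟨⟨(Complex.neg_pi_lt_arg q).le, Complex.arg_le_pi q⟩,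
    (Complex.neg_pi_lt_arg r).le, Complex.arg_le_pi r⟩, ?_⟩
  ext i
  fin_cases i
  · simp only [sphereParam]
    simp [← mul_assoc, hq1, hr]
  · simp only [sphereParam]
    simp [← mul_assoc, hq1, hr]
  · simp [sphereParam, hq2]

theorem hausdorff_sphere_lt_top : (μH[2] : Measure E3) (sphere 0 3) < ⊤ := by
  have hc : IsCompact (Set.Icc (-π) π ×ˢ Set.Icc (-π) π) := isCompact_Icc.prod isCompact_Icc
  obtain ⟨K, hK⟩ := (contDiff_sphereParam.locallyLipschitz.locallyLipschitzOn
    (s := Set.Icc (-π) π ×ˢ Set.Icc (-π) π)).exists_lipschitzOnWith_of_compact hc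
  refine ((measure_mono sphere_subset_image_sphereParam).trans
    (hK.hausdorffMeasure_image_le zero_le_two)).trans_lt ?_
  rw [hausdorffMeasure_prod_real]
  exact ENNReal.mul_lt_top (ENNReal.rpow_lt_top_of_nonneg zero_le_two ENNReal.coe_ne_top)
    hc.measure_lt_top

/-- The mean over the unit sphere is controlled by the `L²` norm for the Hausdorff measure. -/
theorem exists_integral_surf_le : ∃ C : ℝ, 0 < C ∧ ∀ g : E3 → ℝ,
    ContinuousOn g (sphere 0 3) → (∀ y, 0 ≤ g y) →
      ∫ u, g ((3 : ℝ) • u.1) ∂surf ≤ C * √(∫ y in sphere (0 : E3) 3, g y ^ 2 ∂μH[2]) := by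
  set K : ENNReal := 48 * volume (ball (0 : E3) 1) with hK
  have hKt : K ≠ ⊤ := ENNReal.mul_ne_top (by norm_num) measure_ball_lt_top.ne
  set V : ℝ := surf.real Set.univ with hV
  refine ⟨√V * √K.toReal + 1, by positivity, fun g hg hg0 => ?_⟩
  set ν : Measure E3 := (μH[2] : Measure E3).restrict (sphere 0 3) with hν
  have hemb : MeasurableEmbedding fun u : sphere (0 : E3) 1 => (3 : ℝ) • u.1 :=
    (measurableEmbedding_const_smul₀ (by norm_num : (3 : ℝ) ≠ 0)).comp
      (MeasurableEmbedding.subtype_coe isClosed_sphere.measurableSet)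
  have hmem : ∀ u : sphere (0 : E3) 1, (3 : ℝ) • u.1 ∈ sphere (0 : E3) 3 := fun u => by
    have hu : ‖u.1‖ = 1 := mem_sphere_zero_iff_norm.1 u.2
    simp [norm_smul]
  have hle : surf₃ ≤ K • ν := by
    have h1 : surf₃.restrict (sphere 0 3) = surf₃ := by
      rw [surf₃, hemb.restrict_map]
      congr 1
      rw [Set.preimage_eq_univ_iff.2 (Set.range_subset_iff.2 hmem), Measure.restrict_univ]
    rw [← h1, hν, ← Measure.restrict_smul]
    exact Measure.restrict_mono le_rfl surf₃_le_hausdorff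
  have hcont : Continuous fun u : sphere (0 : E3) 1 => g ((3 : ℝ) • u.1) :=
    hg.comp_continuous (by fun_prop) hmem
  have hfin : IsFiniteMeasure ν := ⟨by simpa [hν] using hausdorff_sphere_lt_top⟩
  have hint : Integrable (fun y => g y ^ 2) ν := by
    obtain ⟨M, hM⟩ := (isCompact_sphere (0 : E3) 3).exists_bound_of_continuousOn (hg.pow 2)
    refine Integrable.of_bound ((hg.pow 2).aestronglyMeasurable isClosed_sphere.measurableSet) M ?_
    exact (ae_restrict_iff' isClosed_sphere.measurableSet).2 (Eventually.of_forall hM)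
  have hsq : ∫ u, g ((3 : ℝ) • u.1) ^ 2 ∂surf ≤ K.toReal * ∫ y, g y ^ 2 ∂ν := by
    have h1 : ∫ u, g ((3 : ℝ) • u.1) ^ 2 ∂surf = ∫ y, g y ^ 2 ∂surf₃ :=
      (hemb.integral_map fun y => g y ^ 2).symm
    rw [h1, ← smul_eq_mul, ← integral_smul_measure]
    exact integral_mono_measure hle (Eventually.of_forall fun y => sq_nonneg _)
      (hint.smul_measure hKt)
  have hcs : ∫ u, g ((3 : ℝ) • u.1) ∂surf ≤ √V * √(∫ u, g ((3 : ℝ) • u.1) ^ 2 ∂surf) := by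
    have hm : ∀ f : sphere (0 : E3) 1 → ℝ, Continuous f → MemLp f (ENNReal.ofReal 2) surf :=
      fun f hf => hf.memLp_of_hasCompactSupport (HasCompactSupport.of_compactSpace _)
    have := integral_mul_le_Lp_mul_Lq_of_nonneg (μ := surf) Real.HolderConjugate.two_two
      (f := fun _ => (1 : ℝ)) (g := fun u : sphere (0 : E3) 1 => g ((3 : ℝ) • u.1))
      (Eventually.of_forall fun _ => zero_le_one) (Eventually.of_forall fun u => hg0 _)
      (hm _ continuous_const) (hm _ hcont)
    simpa only [one_mul, Real.one_rpow, one_pow, integral_const, smul_eq_mul, mul_one,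
      Real.rpow_two, ← Real.sqrt_eq_rpow] using this
  calc ∫ u, g ((3 : ℝ) • u.1) ∂surf
      ≤ √V * √(∫ u, g ((3 : ℝ) • u.1) ^ 2 ∂surf) := hcs
    _ ≤ √V * √(K.toReal * ∫ y, g y ^ 2 ∂ν) := by gcongr
    _ = √V * √K.toReal * √(∫ y, g y ^ 2 ∂ν) := by
        rw [Real.sqrt_mul ENNReal.toReal_nonneg, mul_assoc]
    _ ≤ (√V * √K.toReal + 1) * √(∫ y, g y ^ 2 ∂ν) := by
        gcongr
        linarith

theorem norm_fderiv_le_sum_abs_pd (f : E3 → ℝ) (x : E3) :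
    ‖fderiv ℝ f x‖ ≤ ∑ k, |pd k f x| := by
  refine ContinuousLinearMap.opNorm_le_bound _
    (Finset.sum_nonneg fun _ _ => abs_nonneg _) fun v => ?_
  have hv : v = ∑ k, v k • EuclideanSpace.single k (1 : ℝ) := by
    ext i
    simp [Finset.sum_apply, Pi.single_apply]
  have hfv : fderiv ℝ f x v = ∑ k, v k * pd k f x := by
    conv_lhs => rw [hv]
    simp [pd]
  rw [hfv, Finset.sum_mul]
  refine (norm_sum_le _ _).trans (Finset.sum_le_sum fun k _ => ?_)
  rw [norm_mul, mul_comm]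
  exact mul_le_mul_of_nonneg_left (PiLp.norm_apply_le v k) (abs_nonneg _)

theorem norm_gradient_eq (f : E3 → ℝ) (x : E3) : ‖gradient f x‖ = ‖fderiv ℝ f x‖ := by
  simp [gradient]

/-- Lemma 4.2: decay of the gradient of a harmonic function that is `O(|x|⁻²)` at infinity. -/
theorem stmt10 :
    ∃ C : ℝ, 0 < C ∧
    ∀ w : E3 → ℝ,
      (∃ s : Set E3, IsOpen s ∧ {x : E3 | 3 ≤ ‖x‖} ⊆ s ∧ IsHarmonicOn w s) →
      (∃ c R : ℝ, ∀ x : E3, R ≤ ‖x‖ → |w x| ≤ c / ‖x‖ ^ 2) →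
      ∀ x : E3, 4 < ‖x‖ →
        ‖gradient w x‖ ≤
          C * Real.sqrt (∫ y in Metric.sphere (0 : E3) 3, ‖gradient w y‖ ^ 2 ∂(μH[2]))
            / ‖x‖ ^ 3 := by
  obtain ⟨C, hC, hmean⟩ := exists_integral_surf_le
  have hk := peakMass_pos
  refine ⟨3 * (9 * ((7 / 2) ^ 2 * 7168) * C / peakMass), by positivity, ?_⟩
  rintro w ⟨s, hs, h3, hw, hΔ⟩ ⟨c, R, hd⟩ x hx
  simp only [norm_gradient_eq]
  set I : ℝ := √(∫ y in sphere (0 : E3) 3, ‖fderiv ℝ w y‖ ^ 2 ∂(μH[2])) with hI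
  have hm : ∫ u, ‖fderiv ℝ w ((3 : ℝ) • u.1)‖ ∂surf ≤ C * I := by
    refine hmean (fun y => ‖fderiv ℝ w y‖) ?_ fun y => norm_nonneg _
    refine ((hw.continuousOn_fderiv_of_isOpen hs (by norm_num)).mono fun y hy => h3 ?_).norm
    have : ‖y‖ = 3 := by simpa using hy
    exact this.ge
  have hpd : ∀ k, |pd k w x| ≤ 9 * ((7 / 2) ^ 2 * (7168 / ‖x‖ ^ 3 * (C * I))) / peakMass := by
    intro k
    rw [le_div_iff₀ hk, mul_comm]
    refine (peakMass_mul_abs_pd_le hs h3 hw hΔ hd hx.le k).trans ?_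
    gcongr
  refine (norm_fderiv_le_sum_abs_pd w x).trans ((Finset.sum_le_sum fun k _ => hpd k).trans ?_)
  refine le_of_eq ?_
  simp only [Finset.sum_const, Finset.card_univ, Fintype.card_fin, nsmul_eq_mul]
  push_cast
  ring
end
end
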